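/- arXiv:1509.05468 — 6 statements merged into one kernel-verified Lean document; each statement's English description precedes it below -/
import Mathlib

section
/- Let Q be an LC loop (a loop satisfying x·(x·(y·z)) = (x·(x·y))·z for all x,y,z) which is an AIM loop. Then every associator of Q lies in the nucleus of Q; that is, for all x, y, z, u, v in Q, the identities [[x,y,z],u,v] = 1, [u,[x,y,z],v] = 1 and [u,v,[x,y,z]] = 1 hold. -/
/-- A loop: a set with multiplication, left division, right division and identity. -/
structure LoopStr (Q : Type*) where
  mul : Q → Q → Q
  ld : Q → Q → Q
  rd : Q → Q → Q
  one : Q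
  one_mul : ∀ x, mul one x = x
  mul_one : ∀ x, mul x one = x
  ld_mul : ∀ x y, ld x (mul x y) = y
  mul_ld : ∀ x y, mul x (ld x y) = y
  rd_mul : ∀ x y, rd (mul x y) y = x
  mul_rd : ∀ x y, mul (rd x y) y = x

namespace LoopStr

variable {Q : Type*}

/-- The associator `[x,y,z] = (x·(y·z)) \ ((x·y)·z)`. -/
def assoc (L : LoopStr Q) (x y z : Q) : Q :=
  L.ld (L.mul x (L.mul y z)) (L.mul (L.mul x y) z)

/-- The commutator `[x,y] = (y·x) \ (x·y)`. -/
def comm (L : LoopStr Q) (x y : Q) : Q :=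
  L.ld (L.mul y x) (L.mul x y)

/-- `T(u,x) = x \ (u·x)`. -/
def Tm (L : LoopStr Q) (u x : Q) : Q := L.ld x (L.mul u x)

/-- `L(u,x,y) = (y·x) \ (y·(x·u))`. -/
def Lm (L : LoopStr Q) (u x y : Q) : Q :=
  L.ld (L.mul y x) (L.mul y (L.mul x u))

/-- `R(u,x,y) = ((u·x)·y) / (x·y)`. -/
def Rm (L : LoopStr Q) (u x y : Q) : Q :=
  L.rd (L.mul (L.mul u x) y) (L.mul x y)

/-- The six AIM identities: the inner mapping generators commute. -/
def IsAIM (L : LoopStr Q) : Prop :=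
  (∀ u x y, L.Tm (L.Tm u x) y = L.Tm (L.Tm u y) x) ∧
  (∀ u x y z w, L.Lm (L.Lm u x y) z w = L.Lm (L.Lm u z w) x y) ∧
  (∀ u x y z w, L.Rm (L.Rm u x y) z w = L.Rm (L.Rm u z w) x y) ∧
  (∀ u x y z, L.Tm (L.Lm u x y) z = L.Lm (L.Tm u z) x y) ∧
  (∀ u x y z, L.Tm (L.Rm u x y) z = L.Rm (L.Tm u z) x y) ∧
  (∀ u x y z w, L.Lm (L.Rm u x y) z w = L.Rm (L.Lm u z w) x y)

/-- Membership in the nucleus `N(Q)`. -/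
def inNucleus (L : LoopStr Q) (a : Q) : Prop :=
  (∀ x y, L.mul (L.mul a x) y = L.mul a (L.mul x y)) ∧
  (∀ x y, L.mul (L.mul x a) y = L.mul x (L.mul a y)) ∧
  (∀ x y, L.mul (L.mul x y) a = L.mul x (L.mul y a))

/-- Membership in the center `Z(Q) = C(Q) ∩ N(Q)`. -/
def inCenter (L : LoopStr Q) (a : Q) : Prop :=
  (∀ x, L.mul a x = L.mul x a) ∧ L.inNucleus a

end LoopStr

namespace LoopStr

variable {Q : Type*}

/-- Left translation by `x`. -/
def lp (L : LoopStr Q) (x : Q) : Equiv.Perm Q where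
  toFun := L.mul x
  invFun := L.ld x
  left_inv := L.ld_mul x
  right_inv := L.mul_ld x

/-- Right translation by `x`. -/
def rp (L : LoopStr Q) (x : Q) : Equiv.Perm Q where
  toFun z := L.mul z x
  invFun z := L.rd z x
  left_inv z := L.rd_mul z x
  right_inv z := L.mul_rd z x

/-- The multiplication group. -/
def mlt (L : LoopStr Q) : Subgroup (Equiv.Perm Q) :=
  Subgroup.closure (Set.range L.lp ∪ Set.range L.rp)

/-- The inner mapping group, as the stabilizer of the identity in the multiplication group. -/
def inn (L : LoopStr Q) : Subgroup (Equiv.Perm Q) where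
  carrier := {g | g ∈ L.mlt ∧ g L.one = L.one}
  mul_mem' := fun ⟨ha, ha'⟩ ⟨hb, hb'⟩ => ⟨mul_mem ha hb, by simp [hb', ha']⟩
  one_mem' := ⟨one_mem _, rfl⟩
  inv_mem' := fun ⟨ha, ha'⟩ => ⟨inv_mem ha, by rw [Equiv.Perm.inv_eq_iff_eq, ha']⟩

/-- The inner mapping `x \ (u * x)`, as a permutation. -/
def T (L : LoopStr Q) (x : Q) : Equiv.Perm Q := (L.lp x)⁻¹ * L.rp x

/-- The middle inner mapping `x \ ((x * (z * u)) / u)`. -/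
def M (L : LoopStr Q) (x u : Q) : Equiv.Perm Q := (L.lp x)⁻¹ * (L.rp u)⁻¹ * L.lp x * L.rp u

/-- The left inner mapping `(x * y) \ (x * (y * z))`. -/
def E (L : LoopStr Q) (x y : Q) : Equiv.Perm Q := (L.lp (L.mul x y))⁻¹ * L.lp x * L.lp y

/-- The right inner mapping `((z * y) * u) / (y * u)`. -/
def V (L : LoopStr Q) (y u : Q) : Equiv.Perm Q := (L.rp (L.mul y u))⁻¹ * L.rp u * L.rp y

/-- The deviation of `h` from being an automorphism:
`h (x * z) = h x * D h x (h z)`. -/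
def D (L : LoopStr Q) (h : Equiv.Perm Q) (x : Q) : Equiv.Perm Q :=
  (L.lp (h x))⁻¹ * h * L.lp x * h⁻¹

/-- The displacement `h x / x`. -/
def s (L : LoopStr Q) (h : Equiv.Perm Q) (x : Q) : Q := L.rd (h x) x

section basic

variable (L : LoopStr Q)

@[simp] theorem lp_apply (x y : Q) : L.lp x y = L.mul x y := rfl
@[simp] theorem rp_apply (x y : Q) : L.rp x y = L.mul y x := rfl
@[simp] theorem lp_symm_apply (x y : Q) : (L.lp x).symm y = L.ld x y := rfl
@[simp] theorem rp_symm_apply (x y : Q) : (L.rp x).symm y = L.rd y x := rfl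

theorem ld_eq {x y z : Q} (h : L.mul x z = y) : L.ld x y = z := by rw [← h, L.ld_mul]
theorem rd_eq {x y z : Q} (h : L.mul z x = y) : L.rd y x = z := by rw [← h, L.rd_mul]
theorem mul_left_cancel' {x y z : Q} (h : L.mul x y = L.mul x z) : y = z := by
  rw [← L.ld_mul x y, h, L.ld_mul]
theorem mul_right_cancel' {x y z : Q} (h : L.mul y x = L.mul z x) : y = z := by
  rw [← L.rd_mul y x, h, L.rd_mul]

theorem lp_injective : Function.Injective L.lp := fun x y h => by
  have := congrArg (fun g : Equiv.Perm Q => g L.one) h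
  simpa [L.mul_one] using this

theorem lp_one : L.lp L.one = 1 := by ext z; simp [L.one_mul]

theorem lp_mem (x : Q) : L.lp x ∈ L.mlt := Subgroup.subset_closure (Or.inl ⟨x, rfl⟩)
theorem rp_mem (x : Q) : L.rp x ∈ L.mlt := Subgroup.subset_closure (Or.inr ⟨x, rfl⟩)

theorem T_mem (x : Q) : L.T x ∈ L.inn :=
  ⟨mul_mem (inv_mem (L.lp_mem x)) (L.rp_mem x), by simp [T, L.one_mul, L.ld_eq (L.mul_one x)]⟩

theorem M_mem (x u : Q) : L.M x u ∈ L.inn :=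
  ⟨mul_mem (mul_mem (mul_mem (inv_mem (L.lp_mem x)) (inv_mem (L.rp_mem u))) (L.lp_mem x))
    (L.rp_mem u), by simp [M, L.one_mul, L.rd_mul, L.ld_eq (L.mul_one x)]⟩

theorem E_mem (x y : Q) : L.E x y ∈ L.inn :=
  ⟨mul_mem (mul_mem (inv_mem (L.lp_mem _)) (L.lp_mem x)) (L.lp_mem y), by
    simp [E, L.mul_one, L.ld_eq (L.mul_one _)]⟩

theorem V_mem (y u : Q) : L.V y u ∈ L.inn :=
  ⟨mul_mem (mul_mem (inv_mem (L.rp_mem _)) (L.rp_mem u)) (L.rp_mem y), by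
    simp [V, L.one_mul, L.rd_eq (L.one_mul _)]⟩

variable {L}

theorem apply_one {h : Equiv.Perm Q} (hh : h ∈ L.inn) : h L.one = L.one := hh.2

theorem symm_apply_one {h : Equiv.Perm Q} (hh : h ∈ L.inn) : h.symm L.one = L.one :=
  (inv_mem hh).2

theorem D_mem {h : Equiv.Perm Q} (hh : h ∈ L.inn) (x : Q) : L.D h x ∈ L.inn :=
  ⟨mul_mem (mul_mem (mul_mem (inv_mem (L.lp_mem _)) hh.1) (L.lp_mem x)) (inv_mem hh.1), by
    simp [D, symm_apply_one hh, L.mul_one, L.ld_eq (L.mul_one _)]⟩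

variable (L)

theorem lp_mul_lp (x y : Q) : L.lp x * L.lp y = L.lp (L.mul x y) * L.E x y := by
  simp [E, mul_assoc]

theorem rp_eq (x : Q) : L.rp x = L.lp x * L.T x := by simp [T]

theorem lp_mul_rp (x u : Q) : L.lp x * L.rp u = L.rp u * L.lp x * L.M x u := by
  simp [M, mul_assoc]

theorem rp_conj_lp (x u : Q) : (L.rp u)⁻¹ * L.lp x * L.rp u = L.lp x * L.M x u := by
  simp [M, mul_assoc]

theorem rp_mul_rp (x y : Q) : L.rp y * L.rp x = L.rp (L.mul x y) * L.V x y := by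
  simp [V, mul_assoc]

theorem conj_lp (h : Equiv.Perm Q) (x : Q) : h * L.lp x = L.lp (h x) * L.D h x * h := by
  simp [D, mul_assoc]

theorem apply_mul (h : Equiv.Perm Q) (x z : Q) :
    h (L.mul x z) = L.mul (h x) (L.D h x (h z)) := by
  simp [D, L.mul_ld]

theorem T_self (x : Q) : L.T x x = x := by simp [T, L.ld_mul]

theorem mul_T (x y : Q) : L.mul x (L.T x y) = L.mul y x := by simp [T, L.mul_ld]

theorem s_mul (h : Equiv.Perm Q) (x : Q) : L.mul (L.s h x) x = h x := L.mul_rd _ _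

theorem eq_s {h : Equiv.Perm Q} {x c : Q} (hc : L.mul c x = h x) : L.s h x = c :=
  L.rd_eq hc

end basic

theorem inn_le_closure (L : LoopStr Q) :
    L.inn ≤ Subgroup.closure (Set.range L.T ∪ (Set.range fun p : Q × Q => L.E p.1 p.2) ∪
      Set.range fun p : Q × Q => L.V p.1 p.2) := by
  set K := Subgroup.closure (Set.range L.T ∪ (Set.range fun p : Q × Q => L.E p.1 p.2) ∪
      Set.range fun p : Q × Q => L.V p.1 p.2) with hK
  have hT : ∀ x, L.T x ∈ K := fun x => Subgroup.subset_closure (Or.inl (Or.inl ⟨x, rfl⟩))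
  have hE : ∀ x y, L.E x y ∈ K := fun x y =>
    Subgroup.subset_closure (Or.inl (Or.inr ⟨(x, y), rfl⟩))
  have hV : ∀ x y, L.V x y ∈ K := fun x y => Subgroup.subset_closure (Or.inr ⟨(x, y), rfl⟩)
  have hlp : ∀ y x, ∃ z, ∃ k ∈ K, L.lp y * L.lp x = L.lp z * k := fun y x =>
    ⟨_, _, hE y x, L.lp_mul_lp y x⟩
  have hlp' : ∀ y x, ∃ z, ∃ k ∈ K, (L.lp y)⁻¹ * L.lp x = L.lp z * k := fun y x =>
    ⟨L.ld y x, (L.E y (L.ld y x))⁻¹, inv_mem (hE _ _), by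
      have := L.lp_mul_lp y (L.ld y x)
      rw [L.mul_ld] at this
      rw [inv_mul_eq_iff_eq_mul, ← mul_assoc, this]; group⟩
  have key : ∀ y x, L.rp y * L.lp x = L.lp (L.mul x y) * (L.T (L.mul x y) * L.V x y *
      (L.T x)⁻¹) := fun y x => by
    rw [← mul_assoc, ← mul_assoc, ← L.rp_eq, ← L.rp_mul_rp, L.rp_eq x]; group
  have hrp : ∀ y x, ∃ z, ∃ k ∈ K, L.rp y * L.lp x = L.lp z * k := fun y x =>
    ⟨_, _, mul_mem (mul_mem (hT _) (hV _ _)) (inv_mem (hT _)), key y x⟩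
  have hrp' : ∀ y x, ∃ z, ∃ k ∈ K, (L.rp y)⁻¹ * L.lp x = L.lp z * k := fun y x =>
    ⟨L.rd x y, _, inv_mem (mul_mem (mul_mem (hT x) (hV (L.rd x y) y)) (inv_mem (hT (L.rd x y)))),
      by
      have := key y (L.rd x y)
      rw [L.mul_rd] at this
      rw [inv_mul_eq_iff_eq_mul, ← mul_assoc, this]; group⟩
  have main : ∀ g ∈ L.mlt, ∀ x, ∃ z, ∃ k ∈ K, g * L.lp x = L.lp z * k := by
    intro g hg
    refine Subgroup.closure_induction_left (p := fun g _ => ∀ x, ∃ z, ∃ k ∈ K,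
      g * L.lp x = L.lp z * k) ?_ ?_ ?_ hg
    · exact fun x => ⟨x, 1, one_mem _, by simp⟩
    · rintro a ha b _ hb x
      obtain ⟨z, k, hk, h⟩ := hb x
      have : ∃ z', ∃ k' ∈ K, a * L.lp z = L.lp z' * k' := by
        rcases ha with ⟨y, rfl⟩ | ⟨y, rfl⟩
        exacts [hlp y z, hrp y z]
      obtain ⟨z', k', hk', h'⟩ := this
      exact ⟨z', k' * k, mul_mem hk' hk, by rw [mul_assoc, h, ← mul_assoc, h', mul_assoc]⟩
    · rintro a ha b _ hb x
      obtain ⟨z, k, hk, h⟩ := hb x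
      have : ∃ z', ∃ k' ∈ K, a⁻¹ * L.lp z = L.lp z' * k' := by
        rcases ha with ⟨y, rfl⟩ | ⟨y, rfl⟩
        exacts [hlp' y z, hrp' y z]
      obtain ⟨z', k', hk', h'⟩ := this
      exact ⟨z', k' * k, mul_mem hk' hk, by rw [mul_assoc, h, ← mul_assoc, h', mul_assoc]⟩
  have hK1 : ∀ k ∈ K, k L.one = L.one := by
    intro k hk
    have : K ≤ L.inn := by
      rw [hK, Subgroup.closure_le]
      rintro _ ((⟨x, rfl⟩ | ⟨p, rfl⟩) | ⟨p, rfl⟩)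
      exacts [L.T_mem x, L.E_mem _ _, L.V_mem _ _]
    exact (this hk).2
  rintro g ⟨hg, hg1⟩
  obtain ⟨z, k, hk, h⟩ := main g hg L.one
  have hz : z = L.one := by
    have := congrArg (fun f : Equiv.Perm Q => f L.one) h
    simpa [hK1 k hk, L.mul_one, hg1] using this.symm
  rw [hz, L.lp_one, _root_.mul_one, _root_.one_mul] at h
  exact h ▸ hk

/-- An LC loop whose inner mapping group is abelian. -/
class AimLC (L : LoopStr Q) : Prop where
  lc : ∀ x y z, L.mul x (L.mul x (L.mul y z)) = L.mul (L.mul x (L.mul x y)) z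
  comm : ∀ g ∈ L.inn, ∀ h ∈ L.inn, g * h = h * g

theorem AimLC.of_isAIM (L : LoopStr Q)
    (hLC : ∀ x y z, L.mul x (L.mul x (L.mul y z)) = L.mul (L.mul x (L.mul x y)) z)
    (hAIM : L.IsAIM) : L.AimLC where
  lc := hLC
  comm := by
    obtain ⟨h1, h2, h3, h4, h5, h6⟩ := hAIM
    have hT : ∀ u x, L.T x u = L.Tm u x := fun _ _ => rfl
    have hE : ∀ u x y, L.E y x u = L.Lm u x y := fun _ _ _ => rfl
    have hV : ∀ u x y, L.V x y u = L.Rm u x y := fun _ _ _ => rfl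
    have hc : ∀ g ∈ Set.range L.T ∪ (Set.range fun p : Q × Q => L.E p.1 p.2) ∪
        (Set.range fun p : Q × Q => L.V p.1 p.2), ∀ h ∈ Set.range L.T ∪
        (Set.range fun p : Q × Q => L.E p.1 p.2) ∪
        (Set.range fun p : Q × Q => L.V p.1 p.2), g * h = h * g := by
      rintro _ ((⟨x, rfl⟩ | ⟨⟨x, y⟩, rfl⟩) | ⟨⟨x, y⟩, rfl⟩) _
        ((⟨z, rfl⟩ | ⟨⟨z, w⟩, rfl⟩) | ⟨⟨z, w⟩, rfl⟩) <;> ext u <;>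
        simp only [Equiv.Perm.mul_apply, hT, hE, hV]
      exacts [h1 _ _ _, h4 _ _ _ _, h5 _ _ _ _, (h4 _ _ _ _).symm, h2 _ _ _ _ _,
        h6 _ _ _ _ _, (h5 _ _ _ _).symm, (h6 _ _ _ _ _).symm, h3 _ _ _ _ _]
    intro g hg h hh
    have hg' := L.inn_le_closure hg
    have hh' := L.inn_le_closure hh
    have := (Subgroup.isMulCommutative_closure hc).is_comm.comm ⟨g, hg'⟩ ⟨h, hh'⟩
    exact congrArg Subtype.val this

section

variable {L : LoopStr Q} [L.AimLC]

theorem inn_commute {g h : Equiv.Perm Q} (hg : g ∈ L.inn) (hh : h ∈ L.inn) : Commute g h :=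
  AimLC.comm g hg h hh

theorem inn_apply_comm {g h : Equiv.Perm Q} (hg : g ∈ L.inn) (hh : h ∈ L.inn) (x : Q) :
    g (h x) = h (g x) :=
  congrArg (fun f : Equiv.Perm Q => f x) (AimLC.comm g hg h hh)

theorem lp_sq_commute_rp (x w : Q) : Commute (L.lp x * L.lp x) (L.rp w) := by
  ext y
  exact AimLC.lc x y w

theorem lp_sq (x : Q) : L.lp x * L.lp x = L.lp (L.mul x x) := by
  ext z
  have := AimLC.lc (L := L) x L.one z
  simpa [L.one_mul, L.mul_one] using this

theorem semiconjBy_M (x w : Q) : SemiconjBy (L.lp x) (L.M x w) (L.M x w)⁻¹ := by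
  have h1 := L.rp_conj_lp x w
  have h2 : (L.rp w)⁻¹ * (L.lp x * L.lp x) * L.rp w = L.lp x * L.lp x := by
    rw [mul_assoc, (lp_sq_commute_rp x w).eq, inv_mul_cancel_left]
  have h3 : (L.lp x * L.M x w) * (L.lp x * L.M x w) = L.lp x * L.lp x := by
    rw [← h1, ← h2]; group
  rw [mul_assoc, mul_left_cancel_iff] at h3
  rw [SemiconjBy, eq_inv_mul_iff_mul_eq, h3]

/-- If `lp x` conjugates `k'` to `k`, both commuting with all inner mappings, then so does every
`lp (h x)`. -/
theorem semiconjBy_orbit {L : LoopStr Q} {x : Q} {k k' h : Equiv.Perm Q}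
    (hk : ∀ g ∈ L.inn, Commute g k)
    (hk' : ∀ g ∈ L.inn, Commute g k') (hh : h ∈ L.inn) (hs : SemiconjBy (L.lp x) k' k) :
    SemiconjBy (L.lp (h x)) k' k := by
  have e : L.lp (h x) = h * L.lp x * (h⁻¹ * (L.D h x)⁻¹) := by rw [conj_lp]; group
  rw [e]
  exact (SemiconjBy.mul_left (hk h hh) hs).mul_left
    (hk' _ (mul_mem (inv_mem hh) (inv_mem (D_mem hh x))))

variable (L) in
/-- The inner mappings inverted by all left translations by elements of the orbit of `x`. -/
def inverted (x : Q) : Subgroup (Equiv.Perm Q) where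
  carrier := {m | m ∈ L.inn ∧ ∀ h ∈ L.inn, SemiconjBy (L.lp (h x)) m m⁻¹}
  mul_mem' := fun {a b} ⟨ha, ha'⟩ ⟨hb, hb'⟩ => ⟨mul_mem ha hb, fun h hh => by
    rw [mul_inv_rev, ((inn_commute (inv_mem hb) (inv_mem ha))).eq]
    exact (ha' h hh).mul_right (hb' h hh)⟩
  one_mem' := ⟨one_mem _, fun h _ => by simp⟩
  inv_mem' := fun {a} ⟨ha, ha'⟩ => ⟨inv_mem ha, fun h hh => (ha' h hh).inv_right⟩

theorem M_mem_inverted {h : Equiv.Perm Q} (hh : h ∈ L.inn) (x w : Q) :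
    L.M (h x) w ∈ L.inverted x := by
  have key : ∀ y g, g ∈ L.inn → SemiconjBy (L.lp (g y)) (L.M y w) (L.M y w)⁻¹ := fun y g hg =>
    semiconjBy_orbit (fun _ hf => inn_commute hf (inv_mem (L.M_mem y w)))
      (fun _ hf => inn_commute hf (L.M_mem y w)) hg (semiconjBy_M y w)
  refine ⟨L.M_mem _ _, fun g hg => ?_⟩
  have := key (h x) (g * h⁻¹) (mul_mem hg (inv_mem hh))
  simpa using this

theorem eq_one_of_rp_conj {L : LoopStr Q} {k : Equiv.Perm Q}
    (h : ∀ w, (L.rp w)⁻¹ * k * L.rp w ∈ L.inn) :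
    k = 1 := by
  ext w
  have := (h w).2
  simp only [Equiv.Perm.mul_apply, rp_apply, L.one_mul] at this
  rw [Equiv.Perm.inv_eq_iff_eq, rp_apply, L.one_mul] at this
  exact this

variable (L) in
/-- The group generated by left translations by elements of the orbit of `x`. -/
def orbitGroup (x : Q) : Subgroup (Equiv.Perm Q) :=
  Subgroup.closure {g | ∃ h ∈ L.inn, g = L.lp (h x)}

theorem lp_mem_orbitGroup {L : LoopStr Q} {h : Equiv.Perm Q} (hh : h ∈ L.inn) (x : Q) :
    L.lp (h x) ∈ L.orbitGroup x := Subgroup.subset_closure ⟨h, hh, rfl⟩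

theorem lp_self_mem_orbitGroup {L : LoopStr Q} (x : Q) : L.lp x ∈ L.orbitGroup x :=
  lp_mem_orbitGroup (one_mem _) x

theorem orbitGroup_le_mlt {L : LoopStr Q} (x : Q) : L.orbitGroup x ≤ L.mlt := by
  rw [orbitGroup, Subgroup.closure_le]
  rintro _ ⟨h, _, rfl⟩
  exact L.lp_mem _

theorem orbitGroup_inverted {x : Q} {g m : Equiv.Perm Q} (hg : g ∈ L.orbitGroup x)
    (hm : m ∈ L.inverted x) : SemiconjBy g m m ∨ SemiconjBy g m m⁻¹ := by
  induction hg using Subgroup.closure_induction with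
  | mem _ h => obtain ⟨h, hh, rfl⟩ := h; exact Or.inr (hm.2 h hh)
  | one => exact Or.inl (SemiconjBy.one_left m)
  | mul a b _ _ ha hb =>
    rcases ha with ha | ha <;> rcases hb with hb | hb
    · exact Or.inl (ha.mul_left hb)
    · exact Or.inr (ha.inv_right.mul_left hb)
    · exact Or.inr (ha.mul_left hb)
    · exact Or.inl (by simpa using ha.inv_right.mul_left hb)
  | inv a _ ha =>
    rcases ha with ha | ha
    · exact Or.inl ha.inv_symm_left
    · exact Or.inr (by simpa using ha.inv_symm_left.inv_right)

theorem orbitGroup_rp_conj {x : Q} {g : Equiv.Perm Q} (hg : g ∈ L.orbitGroup x) (w : Q) :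
    ∃ m ∈ L.inverted x, (L.rp w)⁻¹ * g * L.rp w = g * m := by
  have swap : ∀ g ∈ L.orbitGroup x, ∀ m ∈ L.inverted x, ∃ m' ∈ L.inverted x, m * g = g * m' := by
    intro g hg m hm
    rcases orbitGroup_inverted hg hm with h | h
    · exact ⟨m, hm, h.eq.symm⟩
    · exact ⟨m⁻¹, inv_mem hm, by simpa using h.inv_right.eq.symm⟩
  induction hg using Subgroup.closure_induction with
  | mem _ h => obtain ⟨h, hh, rfl⟩ := h; exact ⟨_, M_mem_inverted hh x w, L.rp_conj_lp _ _⟩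
  | one => exact ⟨1, one_mem _, by group⟩
  | mul a b _ hb iha ihb =>
    obtain ⟨m, hm, em⟩ := iha
    obtain ⟨n, hn, en⟩ := ihb
    obtain ⟨m', hm', em'⟩ := swap b hb m hm
    refine ⟨m' * n, mul_mem hm' hn, ?_⟩
    calc (L.rp w)⁻¹ * (a * b) * L.rp w
        = ((L.rp w)⁻¹ * a * L.rp w) * ((L.rp w)⁻¹ * b * L.rp w) := by group
      _ = a * (m * b) * n := by rw [em, en]; group
      _ = _ := by rw [em']; group
  | inv a ha iha =>
    obtain ⟨m, hm, em⟩ := iha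
    obtain ⟨m', hm', em'⟩ := swap a⁻¹ (inv_mem ha) m⁻¹ (inv_mem hm)
    refine ⟨m', hm', ?_⟩
    calc (L.rp w)⁻¹ * a⁻¹ * L.rp w = ((L.rp w)⁻¹ * a * L.rp w)⁻¹ := by group
      _ = m⁻¹ * a⁻¹ := by rw [em]; group
      _ = _ := em'

theorem inverted_le_inn (x : Q) : L.inverted x ≤ L.inn := fun _ h => h.1

theorem orbitGroup_eq_lp {x : Q} {g : Equiv.Perm Q} (hg : g ∈ L.orbitGroup x) :
    g = L.lp (g L.one) := by
  have hk : (L.lp (g L.one))⁻¹ * g ∈ L.inn :=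
    ⟨mul_mem (inv_mem (L.lp_mem _)) (orbitGroup_le_mlt x hg), by
      rw [Equiv.Perm.mul_apply, Equiv.Perm.inv_eq_iff_eq, lp_apply, L.mul_one]⟩
  have := eq_one_of_rp_conj (L := L) (k := (L.lp (g L.one))⁻¹ * g) fun w => by
    obtain ⟨m, hm, em⟩ := orbitGroup_rp_conj hg w
    have e : (L.rp w)⁻¹ * ((L.lp (g L.one))⁻¹ * g) * L.rp w =
        (L.M (g L.one) w)⁻¹ * ((L.lp (g L.one))⁻¹ * g) * m := by
      have h1 := L.rp_conj_lp (g L.one) w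
      calc _ = ((L.rp w)⁻¹ * L.lp (g L.one) * L.rp w)⁻¹ * ((L.rp w)⁻¹ * g * L.rp w) := by group
        _ = _ := by rw [h1, em]; group
    rw [e]
    exact mul_mem (mul_mem (inv_mem (L.M_mem _ _)) hk) (inverted_le_inn x hm)
  exact (inv_mul_eq_one.mp this).symm

theorem lp_orbit_commute {g h : Equiv.Perm Q} (hg : g ∈ L.inn) (hh : h ∈ L.inn) (x : Q) :
    Commute (L.lp (g x)) (L.lp (h x)) := by
  have key : ∀ y, ∀ k ∈ L.inn, Commute (L.lp y) (L.lp (k y)) := by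
    intro y k hk
    have e : L.mul y (k y) = L.mul (k y) y := by
      rw [← L.mul_T y (k y), inn_apply_comm (L.T_mem y) hk, L.T_self]
    have h1 := orbitGroup_eq_lp (mul_mem (lp_self_mem_orbitGroup (L := L) y)
      (lp_mem_orbitGroup hk y))
    have h2 := orbitGroup_eq_lp (mul_mem (lp_mem_orbitGroup hk y)
      (lp_self_mem_orbitGroup (L := L) y))
    rw [Commute, SemiconjBy, h1, h2]
    simp [L.mul_one, e]
  have := key (g x) (h * g⁻¹) (mul_mem hh (inv_mem hg))
  simpa using this

theorem orbitGroup_commute {x : Q} {a b : Equiv.Perm Q} (ha : a ∈ L.orbitGroup x)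
    (hb : b ∈ L.orbitGroup x) : Commute a b := by
  have := (Subgroup.isMulCommutative_closure (k := {g | ∃ h ∈ L.inn, g = L.lp (h x)})
    (by rintro _ ⟨g, hg, rfl⟩ _ ⟨h, hh, rfl⟩; exact lp_orbit_commute hg hh x)).is_comm.comm
      ⟨a, ha⟩ ⟨b, hb⟩
  exact congrArg Subtype.val this

theorem lp_inv (x : Q) : (L.lp x)⁻¹ = L.lp (L.ld x L.one) :=
  orbitGroup_eq_lp (inv_mem (lp_self_mem_orbitGroup x))

variable (L) in
/-- The group generated by the left translations by displacements of the orbit of `x`. -/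
def dispGroup (x : Q) : Subgroup (Equiv.Perm Q) :=
  Subgroup.closure {g | ∃ h ∈ L.inn, g = L.lp (h x) * (L.lp x)⁻¹}

theorem dispGroup_le {L : LoopStr Q} (x : Q) : L.dispGroup x ≤ L.orbitGroup x := by
  rw [dispGroup, Subgroup.closure_le]
  rintro _ ⟨h, hh, rfl⟩
  exact mul_mem (lp_mem_orbitGroup hh x) (inv_mem (lp_self_mem_orbitGroup x))

theorem dispGroup_eq_lp {x : Q} {g : Equiv.Perm Q} (hg : g ∈ L.dispGroup x) :
    g = L.lp (g L.one) := orbitGroup_eq_lp (dispGroup_le x hg)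

theorem dispGroup_commute {x : Q} {a b : Equiv.Perm Q} (ha : a ∈ L.dispGroup x)
    (hb : b ∈ L.dispGroup x) : Commute a b :=
  orbitGroup_commute (dispGroup_le x ha) (dispGroup_le x hb)

theorem dispGroup_commute_lp {x : Q} {a h : Equiv.Perm Q} (ha : a ∈ L.dispGroup x)
    (hh : h ∈ L.inn) : Commute a (L.lp (h x)) :=
  orbitGroup_commute (dispGroup_le x ha) (lp_mem_orbitGroup hh x)

theorem dispGroup_commute_lp_self {x : Q} {a : Equiv.Perm Q} (ha : a ∈ L.dispGroup x) :
    Commute a (L.lp x) := dispGroup_commute_lp ha (one_mem _)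

theorem lp_mul_lp_inv_mem {L : LoopStr Q} {g h : Equiv.Perm Q} (hg : g ∈ L.inn) (hh : h ∈ L.inn)
    (x : Q) :
    L.lp (g x) * (L.lp (h x))⁻¹ ∈ L.dispGroup x := by
  have h1 : L.lp (g x) * (L.lp x)⁻¹ ∈ L.dispGroup x := Subgroup.subset_closure ⟨g, hg, rfl⟩
  have h2 : L.lp (h x) * (L.lp x)⁻¹ ∈ L.dispGroup x := Subgroup.subset_closure ⟨h, hh, rfl⟩
  have := mul_mem h1 (inv_mem h2)
  simpa [mul_assoc] using this

theorem dispGroup_orbit_le {L : LoopStr Q} {h : Equiv.Perm Q} (hh : h ∈ L.inn) (x : Q) :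
    L.dispGroup (h x) ≤ L.dispGroup x := by
  rw [dispGroup, Subgroup.closure_le]
  rintro _ ⟨g, hg, rfl⟩
  exact lp_mul_lp_inv_mem (mul_mem hg hh) hh x

theorem dispGroup_orbit {L : LoopStr Q} {h : Equiv.Perm Q} (hh : h ∈ L.inn) (x : Q) :
    L.dispGroup (h x) = L.dispGroup x :=
  le_antisymm (dispGroup_orbit_le hh x) (by
    simpa using dispGroup_orbit_le (inv_mem hh) (h x))

theorem lp_s {h : Equiv.Perm Q} (hh : h ∈ L.inn) (x : Q) :
    L.lp (L.s h x) = L.lp (h x) * (L.lp x)⁻¹ := by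
  have h1 : L.lp (h x) * (L.lp x)⁻¹ ∈ L.dispGroup x := Subgroup.subset_closure ⟨h, hh, rfl⟩
  have h2 := dispGroup_eq_lp h1
  rw [h2]
  congr 1
  apply L.eq_s
  rw [← lp_apply, ← h2]
  simp [L.ld_eq (L.mul_one x), L.mul_one]

theorem lp_s_mem {h : Equiv.Perm Q} (hh : h ∈ L.inn) (x : Q) :
    L.lp (L.s h x) ∈ L.dispGroup x := by
  rw [lp_s hh]; exact Subgroup.subset_closure ⟨h, hh, rfl⟩

theorem lp_apply_eq_s_mul {h : Equiv.Perm Q} (hh : h ∈ L.inn) (x : Q) :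
    L.lp (h x) = L.lp (L.s h x) * L.lp x := by
  rw [lp_s hh]; group

theorem inverted_commute {x : Q} {m g : Equiv.Perm Q} (hm : m ∈ L.inverted x)
    (hg : g ∈ L.dispGroup x) : Commute m g := by
  have hx : SemiconjBy (L.lp x) m m⁻¹ := hm.2 1 (one_mem _)
  induction hg using Subgroup.closure_induction with
  | mem _ h =>
    obtain ⟨h, hh, rfl⟩ := h
    have := (hm.2 h hh).mul_left (by simpa using hx.inv_symm_left.inv_right :
      SemiconjBy (L.lp x)⁻¹ m m⁻¹).inv_right
    have : SemiconjBy (L.lp (h x) * (L.lp x)⁻¹) m⁻¹ m⁻¹ := by simpa using this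
    have : SemiconjBy (L.lp (h x) * (L.lp x)⁻¹) m m := by simpa using this.inv_right
    exact Commute.symm this
  | one => exact Commute.one_right m
  | mul a b _ _ ha hb => exact ha.mul_right hb
  | inv a _ ha => exact ha.inv_right

theorem M_mem_inverted_of_mem {x c : Q} (hc : L.lp c ∈ L.orbitGroup x) (w : Q) :
    L.M c w ∈ L.inverted x := by
  obtain ⟨m, hm, em⟩ := orbitGroup_rp_conj hc w
  rw [L.rp_conj_lp, mul_left_cancel_iff] at em
  rwa [em]

theorem M_sq {x c : Q} (hc : L.lp c ∈ L.dispGroup x) (w : Q) : L.M c w * L.M c w = 1 := by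
  have h1 := inverted_commute (M_mem_inverted_of_mem (dispGroup_le x hc) w) hc
  have h2 := semiconjBy_M (L := L) c w
  rw [SemiconjBy, ← h1.eq, mul_left_inj] at h2
  exact mul_eq_one_iff_eq_inv.mpr h2

/-- The deviation cocycle, in symmetric form. -/
theorem D_cocycle {g h : Equiv.Perm Q} (hg : g ∈ L.inn) (hh : h ∈ L.inn) (x : Q) :
    L.D h (g x) * L.D g x = L.D g (h x) * L.D h x := by
  have key : ∀ a b : Equiv.Perm Q, a ∈ L.inn → b ∈ L.inn →
      L.D a (b x) * L.D b x = L.D (a * b) x := by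
    intro a b ha hb
    have e : a * L.D b x = L.D b x * a := (inn_commute ha (D_mem hb x)).eq
    have : L.D a (b x) * L.D b x = L.D a (b x) * a * L.D b x * a⁻¹ := by
      rw [mul_assoc _ a, e]; group
    rw [this]; simp [D, mul_assoc]
  rw [key h g hh hg, key g h hg hh, (inn_commute hg hh).eq]

/-- An inner mapping fixing `y` commutes with the displacement group of `y`. -/
theorem commute_of_apply_eq {h g : Equiv.Perm Q} {y : Q} (hh : h ∈ L.inn) (hy : h y = y)
    (hg : g ∈ L.dispGroup y) : Commute h g := by
  induction hg using Subgroup.closure_induction with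
  | mem _ h' =>
    obtain ⟨g, hg, rfl⟩ := h'
    have c1 := D_cocycle hg hh y
    rw [hy, (inn_commute (D_mem hg y) (D_mem hh y)).eq, mul_left_inj] at c1
    have e1 := L.conj_lp h (g y)
    have e2 := L.conj_lp h y
    rw [inn_apply_comm hh hg, hy, c1] at e1
    rw [hy] at e2
    have e3 : (L.lp y)⁻¹ * h = L.D h y * h * (L.lp y)⁻¹ := by
      rw [inv_mul_eq_iff_eq_mul, ← mul_assoc, ← mul_assoc, ← e2]; group
    rw [Commute, SemiconjBy, ← mul_assoc, e1, mul_assoc (L.lp (g y)) _ h, mul_assoc (L.lp (g y)),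
      ← e3, mul_assoc]
  | one => exact Commute.one_right h
  | mul a b _ _ ha hb => exact ha.mul_right hb
  | inv a _ ha => exact ha.inv_right

theorem M_self (x w : Q) : L.M x w x = x := by
  have h1 : L.mul x (L.mul x w) = L.mul (L.mul x x) w :=
    congrArg (fun g : Equiv.Perm Q => g w) (lp_sq (L := L) x)
  simp only [M, Equiv.Perm.mul_apply, Equiv.Perm.inv_eq_iff_eq, rp_apply, lp_apply, h1]

theorem V_self (y u : Q) : L.V y u y = y := by
  have h1 : L.mul y (L.mul y u) = L.mul (L.mul y y) u :=
    congrArg (fun g : Equiv.Perm Q => g u) (lp_sq (L := L) y)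
  simp only [V, Equiv.Perm.mul_apply, Equiv.Perm.inv_eq_iff_eq, rp_apply, h1]

theorem T_commute {x : Q} {g : Equiv.Perm Q} (hg : g ∈ L.dispGroup x) : Commute (L.T x) g :=
  commute_of_apply_eq (L.T_mem x) (L.T_self x) hg

theorem M_commute {x : Q} (w : Q) {g : Equiv.Perm Q} (hg : g ∈ L.dispGroup x) :
    Commute (L.M x w) g :=
  commute_of_apply_eq (L.M_mem x w) (M_self x w) hg

theorem V_commute {y : Q} (u : Q) {g : Equiv.Perm Q} (hg : g ∈ L.dispGroup y) :
    Commute (L.V y u) g :=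
  commute_of_apply_eq (L.V_mem y u) (V_self y u) hg

variable (L) in
/-- The elements of the multiplication group commuting with all right translations. -/
def cen : Subgroup (Equiv.Perm Q) where
  carrier := {g | g ∈ L.mlt ∧ ∀ w, Commute g (L.rp w)}
  mul_mem' := fun ⟨ha, ha'⟩ ⟨hb, hb'⟩ => ⟨mul_mem ha hb, fun w => (ha' w).mul_left (hb' w)⟩
  one_mem' := ⟨one_mem _, fun _ => Commute.one_left _⟩
  inv_mem' := fun ⟨ha, ha'⟩ => ⟨inv_mem ha, fun w => (ha' w).inv_left⟩

theorem cen_mul_lp {L : LoopStr Q} {g : Equiv.Perm Q} (hg : g ∈ L.cen) (z : Q) :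
    g * L.lp z = L.lp (g z) := by
  ext w
  exact congrArg (fun f : Equiv.Perm Q => f z) (hg.2 w).eq

theorem cen_eq_lp {L : LoopStr Q} {g : Equiv.Perm Q} (hg : g ∈ L.cen) : g = L.lp (g L.one) := by
  rw [← cen_mul_lp hg, L.lp_one, _root_.mul_one]

theorem lp_sq_mem_cen (x : Q) : L.lp x * L.lp x ∈ L.cen :=
  ⟨mul_mem (L.lp_mem x) (L.lp_mem x), lp_sq_commute_rp x⟩

theorem V_commute_cen {L : LoopStr Q} (y u : Q) {k : Equiv.Perm Q} (hk : k ∈ L.cen) :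
    Commute (L.V y u) k :=
  ((hk.2 _).symm.inv_left.mul_left (hk.2 _).symm).mul_left (hk.2 _).symm

theorem cen_orbit {n : Q} (hn : L.lp n ∈ L.cen) {h : Equiv.Perm Q} (hh : h ∈ L.inn) :
    L.lp (h n) ∈ L.cen := by
  refine ⟨L.lp_mem _, fun u => ?_⟩
  ext y
  have h1 : L.V y u n = n := by
    have : L.V y u (L.lp n L.one) = L.lp n (L.V y u L.one) :=
      congrArg (fun g : Equiv.Perm Q => g L.one) (V_commute_cen y u hn).eq
    rwa [apply_one (L.V_mem y u), lp_apply, L.mul_one] at this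
  have h2 : L.V y u (h n) = h n := by rw [inn_apply_comm (L.V_mem y u) hh, h1]
  simp only [V, Equiv.Perm.mul_apply, Equiv.Perm.inv_eq_iff_eq, rp_apply] at h2
  simpa using h2.symm

theorem lp_mul_cen (x : Q) {k : Equiv.Perm Q} (hk : k ∈ L.cen) :
    L.lp x * k = L.lp (L.mul x (k L.one)) := by
  have h1 := cen_mul_lp (inv_mem hk) (L.ld x L.one)
  rw [← lp_inv, ← mul_inv_rev, inv_eq_iff_eq_inv, lp_inv] at h1
  rw [h1]
  congr 1
  have := congrArg (fun f : Equiv.Perm Q => f L.one) h1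
  simpa [L.mul_one] using this.symm

theorem lp_mul_lp_cen (x : Q) {n : Q} (hn : L.lp n ∈ L.cen) :
    L.lp x * L.lp n = L.lp ((L.T x)⁻¹ n) * L.lp x := by
  have h1 := cen_mul_lp (cen_orbit hn (inv_mem (L.T_mem x))) x
  have h2 : L.mul x n = L.mul ((L.T x)⁻¹ n) x := by
    simpa using L.mul_T x ((L.T x)⁻¹ n)
  rw [h1, lp_mul_cen x hn, lp_apply, lp_apply, L.mul_one, h2]

theorem cen_conj {g k : Equiv.Perm Q} (hg : g ∈ L.mlt) (hk : k ∈ L.cen) :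
    g * k * g⁻¹ ∈ L.cen := by
  have hl : ∀ x, ∀ k ∈ L.cen, L.lp x * k * (L.lp x)⁻¹ ∈ L.cen := by
    intro x k hk
    have e := cen_eq_lp hk
    rw [e, lp_mul_lp_cen x (e ▸ hk), mul_inv_cancel_right]
    exact cen_orbit (e ▸ hk) (inv_mem (L.T_mem x))
  have hl' : ∀ x, ∀ k ∈ L.cen, (L.lp x)⁻¹ * k * L.lp x ∈ L.cen := by
    intro x k hk
    have := hl (L.ld x L.one) k hk
    rwa [← lp_inv, inv_inv] at this
  suffices ∀ k ∈ L.cen, g * k * g⁻¹ ∈ L.cen ∧ g⁻¹ * k * g ∈ L.cen from (this k hk).1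
  induction hg using Subgroup.closure_induction with
  | mem _ h =>
    rcases h with ⟨x, rfl⟩ | ⟨x, rfl⟩
    · exact fun k hk => ⟨hl x k hk, hl' x k hk⟩
    · intro k hk
      constructor
      · rwa [← (hk.2 x).eq, mul_inv_cancel_right]
      · rwa [mul_assoc, (hk.2 x).eq, inv_mul_cancel_left]
  | one => simp
  | mul a b _ _ ha hb =>
    intro k hk
    constructor
    · have := (ha _ (hb k hk).1).1
      simpa [mul_assoc] using this
    · have := (hb _ (ha k hk).2).2
      simpa [mul_assoc] using this
  | inv a _ ha =>
    intro k hk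
    simpa using (ha k hk).symm

theorem inn_mul_lp_cen {h : Equiv.Perm Q} (hh : h ∈ L.inn) {n : Q} (hn : L.lp n ∈ L.cen) :
    h * L.lp n = L.lp (h n) * h := by
  have h1 := cen_eq_lp (cen_conj hh.1 hn)
  have h2 : (h * L.lp n * h⁻¹) L.one = h n := by
    simp [symm_apply_one hh, L.mul_one]
  rw [h2] at h1
  rw [← h1]; group

theorem M_commute_cen (x u : Q) {k : Equiv.Perm Q} (hk : k ∈ L.cen) : Commute (L.M x u) k := by
  have h1 : L.lp x * k * (L.lp x)⁻¹ ∈ L.cen := cen_conj (L.lp_mem x) hk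
  have e : L.lp x * k = L.lp x * k * (L.lp x)⁻¹ * L.lp x := by group
  have h2 := (h1.2 u).inv_right.eq
  calc L.M x u * k = (L.lp x)⁻¹ * (L.rp u)⁻¹ * (L.lp x * k) * L.rp u := by
        rw [M, mul_assoc _ (L.rp u), ← (hk.2 u).eq]; group
    _ = (L.lp x)⁻¹ * ((L.rp u)⁻¹ * (L.lp x * k * (L.lp x)⁻¹)) * L.lp x * L.rp u := by
        rw [e]; group
    _ = _ := by rw [← h2, M]; group

variable (L) in
/-- The element with `M x u y = c x y u * y`; up to inversion and order of factors it measures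
the failure of associativity of `x`, `y`, `u`. -/
def c (x y u : Q) : Q := L.s (L.M x u) y

theorem M_apply {L : LoopStr Q} (x y u : Q) : L.M x u y = L.mul (L.c x y u) y := (L.s_mul _ _).symm

theorem lp_c_mem₂ (x y u : Q) : L.lp (L.c x y u) ∈ L.dispGroup y := lp_s_mem (L.M_mem x u) y

theorem c_eq_s_V (x y u : Q) : L.c x y u = L.s (L.V y u)⁻¹ x := by
  apply L.eq_s
  set x' := (L.V y u)⁻¹ x with hx'
  have h1 : L.V y u x' = x := by simp [hx']
  have hl := lp_apply_eq_s_mul (inv_mem (L.V_mem y u)) x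
  have hl' := dispGroup_commute_lp_self (lp_s_mem (inv_mem (L.V_mem y u)) x)
  rw [← hx'] at hl
  simp only [V, Equiv.Perm.mul_apply, Equiv.Perm.inv_eq_iff_eq, rp_apply] at h1
  have h2 : (L.lp x)⁻¹ (L.mul x' y) = L.mul (L.s (L.V y u)⁻¹ x) y := by
    rw [Equiv.Perm.inv_eq_iff_eq, ← lp_apply, ← lp_apply, ← Equiv.Perm.mul_apply, hl, hl'.eq]
  rw [← h2, M]
  simp only [Equiv.Perm.mul_apply, rp_apply, lp_apply, ← h1]
  congr 1
  exact (L.rd_mul _ _).symm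

attribute [simp] ld_mul mul_ld rd_mul mul_rd

theorem lp_c_mem₁ (x y u : Q) : L.lp (L.c x y u) ∈ L.dispGroup x := by
  rw [c_eq_s_V]; exact lp_s_mem (inv_mem (L.V_mem y u)) x

theorem M_inv_apply (x y u : Q) : (L.M x u)⁻¹ y = (L.lp (L.c x y u))⁻¹ y := by
  have h2 := M_apply (L := L) x y u
  rw [← lp_apply] at h2
  rw [Equiv.Perm.inv_eq_iff_eq, ← Equiv.Perm.mul_apply,
    (M_commute u (lp_c_mem₁ (L := L) x y u)).inv_right.eq, Equiv.Perm.mul_apply, h2]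
  simp

theorem V_apply (x y u : Q) : L.V y u x = (L.lp (L.c x y u))⁻¹ x := by
  have h := (V_commute u (lp_c_mem₂ (L := L) x y u)).eq
  have h2 : L.lp (L.c x y u) x = (L.V y u)⁻¹ x := by
    rw [c_eq_s_V, lp_apply, L.s_mul]
  rw [Equiv.Perm.eq_inv_iff_eq, ← Equiv.Perm.mul_apply, ← h, Equiv.Perm.mul_apply, h2]
  simp

theorem V_inv_apply (x y u : Q) : (L.V y u)⁻¹ x = L.mul (L.c x y u) x := by
  rw [c_eq_s_V, L.s_mul]

theorem lp_c_mem_mul (x y u : Q) : L.lp (L.c x y u) ∈ L.dispGroup (L.mul x y) := by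
  set p := L.lp (L.c x y u) with hp
  have h1 : L.M x u (L.mul x y) = p⁻¹ (L.mul x y) := by
    have h := semiconjBy_M (L := L) x u
    have e : L.M x u * L.lp x = L.lp x * (L.M x u)⁻¹ := by
      simpa using h.inv_right.eq.symm
    have hc := (dispGroup_commute_lp_self (lp_c_mem₁ (L := L) x y u)).inv_left.eq
    have e' := M_inv_apply (L := L) x y u
    calc L.M x u (L.mul x y) = (L.M x u * L.lp x) y := rfl
      _ = L.lp x (p⁻¹ y) := by rw [e, Equiv.Perm.mul_apply, e']
      _ = (p⁻¹ * L.lp x) y := by rw [hc]; rfl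
  have h2 : p⁻¹ = L.lp (L.s (L.M x u) (L.mul x y)) := by
    rw [hp, lp_inv] at h1 ⊢
    rw [L.eq_s h1.symm]
  rw [← inv_inv p, h2]
  exact inv_mem (lp_s_mem (L.M_mem x u) _)

theorem c_eq_s_E (x y u : Q) : L.c x y u = L.s (L.E x y) u := by
  set p := L.lp (L.c x y u) with hp
  have h0 : (L.rp u)⁻¹ * (L.lp x * L.lp y) * L.rp u =
      L.lp x * L.M x u * (L.lp y * L.M y u) := by
    rw [← L.rp_conj_lp, ← L.rp_conj_lp]; group
  have h0' : (L.rp u)⁻¹ * (L.lp x * L.lp y) * L.rp u =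
      L.lp (L.mul x y) * L.M (L.mul x y) u * ((L.rp u)⁻¹ * L.E x y * L.rp u) := by
    rw [L.lp_mul_lp, ← L.rp_conj_lp]; group
  have h1 := congrArg (fun g : Equiv.Perm Q => g L.one) (h0.symm.trans h0')
  have h2 : ((L.rp u)⁻¹ * L.E x y * L.rp u) L.one = L.s (L.E x y) u := by
    simp only [Equiv.Perm.mul_apply, rp_apply, L.one_mul]; rfl
  simp only [Equiv.Perm.mul_apply] at h1 h2
  rw [h2, apply_one (L.M_mem y u), lp_apply L y, L.mul_one, M_apply] at h1
  have h3 : L.lp x (L.mul (L.c x y u) y) = L.lp (L.mul x y) (L.c x y u) := by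
    have a := (dispGroup_commute_lp_self (lp_c_mem₁ (L := L) x y u)).eq
    have b := (dispGroup_commute_lp_self (lp_c_mem_mul (L := L) x y u)).eq
    have a' := congrArg (fun g : Equiv.Perm Q => g y) a
    have b' := congrArg (fun g : Equiv.Perm Q => g L.one) b
    simp only [Equiv.Perm.mul_apply, lp_apply, L.mul_one] at a' b' ⊢
    rw [← a', b']
  rw [h3] at h1
  have h4 := (L.lp (L.mul x y)).injective h1
  have h5 := (M_commute u (lp_c_mem_mul (L := L) x y u)).eq
  have h6 := congrArg (fun g : Equiv.Perm Q => g L.one) h5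
  simp only [Equiv.Perm.mul_apply, lp_apply, L.mul_one, apply_one (L.M_mem _ u)] at h6
  exact (L.M (L.mul x y) u).injective (h6.trans h4)

theorem lp_c_mem₃ (x y u : Q) : L.lp (L.c x y u) ∈ L.dispGroup u := by
  rw [c_eq_s_E]; exact lp_s_mem (L.E_mem x y) u

theorem E_apply (x y u : Q) : L.E x y u = L.mul (L.c x y u) u := by
  rw [c_eq_s_E, L.s_mul]

theorem mul_assoc_c (x y u : Q) :
    L.mul x (L.mul y u) = L.mul (L.c x y u) (L.mul (L.mul x y) u) := by
  have b := (dispGroup_commute_lp_self (lp_c_mem_mul (L := L) x y u)).eq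
  have b' := congrArg (fun g : Equiv.Perm Q => g u) b
  have e := congrArg (fun g : Equiv.Perm Q => g u) (L.lp_mul_lp x y)
  simp only [Equiv.Perm.mul_apply, lp_apply, E_apply] at b' e
  rw [e, b']

/-! ### Equivariance of displacements -/

theorem conj_lp_ratio {g h : Equiv.Perm Q} (hg : g ∈ L.inn) (hh : h ∈ L.inn) (y : Q) :
    h * (L.lp (g y) * (L.lp y)⁻¹) =
      L.lp (g (h y)) * (L.D h (g y) * (L.D h y)⁻¹) * (L.lp (h y))⁻¹ * h := by
  have e1 := L.conj_lp h (g y)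
  have e2 := L.conj_lp h y
  rw [inn_apply_comm hh hg] at e1
  have c := (inn_commute hh (inv_mem (D_mem hh y))).eq
  have e3 : h * (L.lp y)⁻¹ = (L.D h y)⁻¹ * (L.lp (h y))⁻¹ * h := by
    rw [mul_inv_eq_iff_eq_mul, mul_assoc, e2]; group
  rw [← mul_assoc, e1, mul_assoc _ h, e3]; group

theorem D_ratio {g h : Equiv.Perm Q} (hg : g ∈ L.inn) (hh : h ∈ L.inn) (y : Q) :
    L.D h (g y) * (L.D h y)⁻¹ = L.D g (h y) * (L.D g y)⁻¹ := by
  rw [mul_inv_eq_iff_eq_mul, mul_assoc, ← (inn_commute (D_mem hh y) (inv_mem (D_mem hg y))).eq,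
    ← mul_assoc, ← D_cocycle hg hh, mul_inv_cancel_right]

theorem lp_s_apply_one {g : Equiv.Perm Q} (hg : g ∈ L.inn) (y : Q) :
    (L.lp (g y) * (L.lp y)⁻¹) L.one = L.s g y := by
  rw [← lp_s hg, lp_apply, L.mul_one]

theorem apply_s_eq {g h : Equiv.Perm Q} (hg : g ∈ L.inn) (hh : h ∈ L.inn) (y : Q) :
    h (L.s g y) = L.lp (g (h y)) ((L.D h (g y) * (L.D h y)⁻¹) ((L.lp (h y))⁻¹ L.one)) := by
  rw [← lp_s_apply_one hg, ← Equiv.Perm.mul_apply, conj_lp_ratio hg hh]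
  simp only [Equiv.Perm.mul_apply, apply_one hh]

theorem apply_s_iff {g h : Equiv.Perm Q} (hg : g ∈ L.inn) (hh : h ∈ L.inn) (y : Q) :
    h (L.s g y) = L.s g (h y) ↔
      (L.D h (g y) * (L.D h y)⁻¹) ((L.lp (h y))⁻¹ L.one) = (L.lp (h y))⁻¹ L.one := by
  rw [apply_s_eq hg hh, ← lp_s_apply_one hg, Equiv.Perm.mul_apply (L.lp _),
    (L.lp _).injective.eq_iff]

theorem apply_s_of {g h : Equiv.Perm Q} (hg : g ∈ L.inn) (hh : h ∈ L.inn) {y : Q}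
    (hC : ∀ k ∈ L.cen, Commute g k)
    (hd : ∀ j ∈ L.inn, g⁻¹ (j y) = (L.lp (L.s g (j y)))⁻¹ (j y)) :
    h (L.s g y) = L.s g (h y) := by
  have hD : ∀ j ∈ L.inn, L.D g (j y) (j y) = g⁻¹ (g⁻¹ (j y)) := by
    intro j hj
    have hdj := hd j hj
    generalize j y = w at hdj ⊢
    have e1 : g (L.mul w w) = L.mul w w := by
      have := congrArg (fun f : Equiv.Perm Q => f L.one) (hC _ (lp_sq_mem_cen w)).eq
      simpa [L.mul_one, apply_one hg] using this
    have e2 : L.D g w (g w) = g⁻¹ w := by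
      have : L.D g w (g w) = (L.lp (g w))⁻¹ (g (L.mul w w)) := by simp [D]
      rw [this, e1, hdj, lp_apply_eq_s_mul hg]
      rw [mul_inv_rev, ← (dispGroup_commute_lp_self (lp_s_mem hg w)).inv_inv.eq]
      simp
    rw [← e2, inn_apply_comm (inv_mem hg) (D_mem hg w)]
    simp
  rw [apply_s_iff hg hh]
  have hfix : (L.D h (g y) * (L.D h y)⁻¹) (h y) = h y := by
    have e1 : (L.D g y)⁻¹ (h y) = h (g (g y)) := by
      have := hD 1 (one_mem _)
      rw [Equiv.Perm.one_apply, inn_apply_comm (inv_mem hg) (inv_mem hg)] at this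
      rw [inn_apply_comm (inv_mem (D_mem hg y)) hh]
      congr 1
      rw [Equiv.Perm.inv_eq_iff_eq, inn_apply_comm (D_mem hg y) hg,
        inn_apply_comm (D_mem hg y) hg, this]
      simp
    have e2 := hD h hh
    rw [D_ratio hg hh, Equiv.Perm.mul_apply, e1, inn_apply_comm hh hg, inn_apply_comm hh hg,
      inn_apply_comm (D_mem hg _) hg, inn_apply_comm (D_mem hg _) hg, e2]
    simp
  set d := L.D h (g y) * (L.D h y)⁻¹ with hd'
  have hcom : Commute d (L.lp (h y) * L.lp (h y)) := by
    have hor : ∀ j ∈ L.inn, Commute (L.D g (j y)) (L.lp (h y) * L.lp (h y)) := by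
      intro j hj
      have a1 : Commute (L.lp (g (j y))) (L.lp (h y) * L.lp (h y)) :=
        (lp_orbit_commute (mul_mem hg hj) hh y).mul_right (lp_orbit_commute (mul_mem hg hj) hh y)
      have a2 : Commute (L.lp (j y)) (L.lp (h y) * L.lp (h y)) :=
        (lp_orbit_commute hj hh y).mul_right (lp_orbit_commute hj hh y)
      have a3 := hC _ (lp_sq_mem_cen (h y))
      exact ((a1.inv_left.mul_left a3).mul_left a2).mul_left a3.inv_left
    rw [hd', D_ratio hg hh]
    exact (hor h hh).mul_left (hor 1 (one_mem _)).inv_left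
  have e : (L.lp (h y))⁻¹ L.one = (L.lp (h y) * L.lp (h y))⁻¹ (h y) := by
    rw [mul_inv_rev, Equiv.Perm.mul_apply]
    congr 1
    rw [eq_comm, Equiv.Perm.inv_eq_iff_eq, lp_apply, L.mul_one]
  rw [e, ← Equiv.Perm.mul_apply, hcom.inv_right.eq, Equiv.Perm.mul_apply, hfix]

/-- Equivariance of `c` in its second argument. -/
theorem apply_c₂ {h : Equiv.Perm Q} (hh : h ∈ L.inn) (x y u : Q) :
    h (L.c x y u) = L.c x (h y) u :=
  apply_s_of (L.M_mem x u) hh (fun _ hk => M_commute_cen x u hk) fun j _ =>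
    M_inv_apply x (j y) u

/-- Equivariance of `c` in its first argument. -/
theorem apply_c₁ {h : Equiv.Perm Q} (hh : h ∈ L.inn) (x y u : Q) :
    h (L.c x y u) = L.c (h x) y u := by
  rw [c_eq_s_V, c_eq_s_V]
  refine apply_s_of (inv_mem (L.V_mem y u)) hh (fun _ hk => (V_commute_cen y u hk).inv_left)
    fun j _ => ?_
  rw [inv_inv, V_apply, c_eq_s_V]

/-! ### Consequences of equivariance of a displacement -/

theorem D_s {g h : Equiv.Perm Q} {y : Q} (hg : g ∈ L.inn) (hh : h ∈ L.inn)
    (heq : h (L.s g y) = L.s g (h y)) :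
    L.D h (L.s g y) =
    L.lp (h y) * (L.D h (g y) * (L.D h y)⁻¹) * (L.lp (h y))⁻¹ := by
  have e := conj_lp_ratio hg hh y
  rw [D, heq, lp_s hg, lp_s hg, mul_assoc _ h, e]; group

theorem D_s_fixes {g h : Equiv.Perm Q} {y : Q} (hg : g ∈ L.inn) (hh : h ∈ L.inn)
    (heq : h (L.s g y) = L.s g (h y)) :
    L.D h (L.s g y) y = y := by
  have h1 := (apply_s_iff hg hh y).1 heq
  have h2 : L.D h (L.s g y) (h y) = h y := by
    have e : (L.lp (h y))⁻¹ (h y) = L.one := by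
      rw [Equiv.Perm.inv_eq_iff_eq, lp_apply, L.mul_one]
    rw [D_s hg hh heq, Equiv.Perm.mul_apply, e, Equiv.Perm.mul_apply, apply_one, lp_apply,
      L.mul_one]
    exact mul_mem (D_mem hh _) (inv_mem (D_mem hh _))
  rw [inn_apply_comm (D_mem hh _) hh] at h2
  exact h.injective h2

theorem apply_s_symm {g h : Equiv.Perm Q} {y : Q} (hg : g ∈ L.inn) (hh : h ∈ L.inn)
    (heq : h (L.s g y) = L.s g (h y)) :
    g (L.s h y) = L.s h (g y) := by
  rw [apply_s_iff hh hg, ← D_ratio hg hh]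
  have h1 : L.D h (g y) * (L.D h y)⁻¹ =
      (L.lp (h y))⁻¹ * L.D h (L.s g y) * L.lp (h y) := by
    rw [D_s hg hh heq]; group
  have h2 := commute_of_apply_eq (D_mem hh _) (D_s_fixes hg hh heq)
    (lp_mul_lp_inv_mem (L := L) hh hg y)
  have h3 := congrArg (fun f : Equiv.Perm Q => f L.one) h2.eq
  have h4 := apply_one (D_mem hh (L.s g y))
  rw [h1, Equiv.Perm.mul_apply, Equiv.Perm.mul_apply, Equiv.Perm.inv_eq_iff_eq]
  simp only [Equiv.Perm.mul_apply, h4] at h3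
  exact h3

theorem D_s_symm {g h : Equiv.Perm Q} {y : Q} (hg : g ∈ L.inn) (hh : h ∈ L.inn)
    (heq : h (L.s g y) = L.s g (h y)) :
    L.D g (L.s h y) = L.D h (L.s g y) := by
  have h1 : L.D h (g y) * (L.D h y)⁻¹ =
      (L.lp (h y))⁻¹ * L.D h (L.s g y) * L.lp (h y) := by
    rw [D_s hg hh heq]; group
  have h2 := commute_of_apply_eq (D_mem hh _) (D_s_fixes hg hh heq)
    (lp_mul_lp_inv_mem (L := L) hg hh y)
  rw [D_s hh hg (apply_s_symm hg hh heq), ← D_ratio hg hh, h1]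
  calc _ = (L.lp (g y) * (L.lp (h y))⁻¹) * L.D h (L.s g y) *
        (L.lp (g y) * (L.lp (h y))⁻¹)⁻¹ := by group
    _ = _ := by rw [← h2.eq, mul_inv_cancel_right]

theorem s_s_comm {g h : Equiv.Perm Q} {y : Q} (hg : g ∈ L.inn) (hh : h ∈ L.inn)
    (heq : h (L.s g y) = L.s g (h y)) :
    L.s h (L.s g y) = L.s g (L.s h y) := by
  apply L.lp_injective
  rw [lp_s hh (L.s g y), lp_s hg (L.s h y), heq, apply_s_symm hg hh heq, lp_s hg, lp_s hg,
    lp_s hh, lp_s hh, inn_apply_comm hh hg]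
  have c1 : Commute (L.lp y) (L.lp (g y)) := by simpa using lp_orbit_commute (one_mem _) hg y
  have c2 : Commute (L.lp y) (L.lp (h y)) := by simpa using lp_orbit_commute (one_mem _) hh y
  have c3 := lp_orbit_commute hg hh y
  have : (L.lp (h y))⁻¹ * (L.lp y * (L.lp (g y))⁻¹) =
      (L.lp (g y))⁻¹ * (L.lp y * (L.lp (h y))⁻¹) := by
    rw [c1.inv_right.eq, c2.inv_right.eq, ← mul_assoc, ← mul_assoc, c3.inv_inv.eq]
  rw [mul_inv_rev, mul_inv_rev, inv_inv, mul_assoc, this, mul_assoc]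

theorem s_c₂ {h : Equiv.Perm Q} (hh : h ∈ L.inn) (x y u : Q) :
    L.s h (L.c x y u) = L.c x (L.s h y) u :=
  s_s_comm (L.M_mem x u) hh (apply_c₂ hh x y u)

theorem s_c₁ {h : Equiv.Perm Q} (hh : h ∈ L.inn) (x y u : Q) :
    L.s h (L.c x y u) = L.c (L.s h x) y u := by
  have := apply_c₁ hh x y u
  simp only [c_eq_s_V] at this ⊢
  exact s_s_comm (inv_mem (L.V_mem y u)) hh this

theorem D_c_fixes₂ {h : Equiv.Perm Q} (hh : h ∈ L.inn) (x y u : Q) :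
    L.D h (L.c x y u) y = y :=
  D_s_fixes (L.M_mem x u) hh (apply_c₂ hh x y u)

/-- Displacements of values of `c` have order dividing two. -/
theorem lp_s_c_sq {h : Equiv.Perm Q} (hh : h ∈ L.inn) (x y u : Q) :
    L.lp (L.s h (L.c x y u)) * L.lp (L.s h (L.c x y u)) = 1 := by
  rw [s_c₁ hh]
  have h1 := M_sq (lp_s_mem hh x) u
  have h2 := (M_commute u (lp_c_mem₁ (L := L) (L.s h x) y u)).eq
  have h3 := M_apply (L := L) (L.s h x) y u
  set q := L.c (L.s h x) y u
  have h4 : y = L.mul q (L.mul q y) := by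
    have e1 := congrArg (fun f : Equiv.Perm Q => f y) h1
    have e2 := congrArg (fun f : Equiv.Perm Q => f y) h2
    simp only [Equiv.Perm.mul_apply, Equiv.Perm.one_apply, lp_apply, h3] at e1 e2
    rw [← e2, e1]
  have h5 : L.lp (L.mul q q) y = L.lp L.one y := by
    rw [← lp_sq, Equiv.Perm.mul_apply, lp_apply, lp_apply, ← h4, lp_apply, L.one_mul]
  rw [lp_sq, L.mul_right_cancel' h5, L.lp_one]

theorem lp_c_sq_apply {h : Equiv.Perm Q} (hh : h ∈ L.inn) (x y u : Q) :
    L.lp (h (L.c x y u)) * L.lp (h (L.c x y u)) = L.lp (L.c x y u) * L.lp (L.c x y u) := by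
  have h1 := lp_s_c_sq hh x y u
  have h2 := lp_apply_eq_s_mul hh (L.c x y u)
  have h3 : Commute (L.lp (L.s h (L.c x y u))) (L.lp (L.c x y u)) :=
    dispGroup_commute_lp_self (lp_s_mem hh _)
  rw [h2, h3.symm.mul_mul_mul_comm, h1, _root_.one_mul]

theorem lp_c_sq_commute {h : Equiv.Perm Q} (hh : h ∈ L.inn) (x y u : Q) :
    Commute h (L.lp (L.c x y u) * L.lp (L.c x y u)) := by
  have h1 : ∀ y, L.M x u (L.M x u y) = (L.lp (L.c x y u) * L.lp (L.c x y u)) y := by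
    intro y
    have h2 := congrArg (fun f : Equiv.Perm Q => f y)
      (M_commute u (lp_c_mem₁ (L := L) x y u)).eq
    simp only [Equiv.Perm.mul_apply, lp_apply] at h2 ⊢
    rw [M_apply x y u, h2, M_apply x y u]
  have h3 := h1 (h y)
  have hn := lp_sq_mem_cen (L := L) (L.c x y u)
  rw [← apply_c₂ hh, lp_c_sq_apply hh, inn_apply_comm (L.M_mem x u) hh,
    inn_apply_comm (L.M_mem x u) hh, h1] at h3
  rw [lp_sq] at h3 hn ⊢
  have h4 := inn_mul_lp_cen hh hn
  rw [← Equiv.Perm.mul_apply, h4, Equiv.Perm.mul_apply] at h3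
  rw [Commute, SemiconjBy, h4, L.mul_right_cancel' h3]

/-! ### Equivariance in the third argument -/

theorem apply_c₃_of_fixes {h : Equiv.Perm Q} (hh : h ∈ L.inn) {x y u : Q}
    (hk : L.D h u (h (L.c x y u)) = h (L.c x y u)) : h (L.c x y u) = L.c x y (h u) := by
  rw [c_eq_s_E x y (h u), eq_comm]
  apply L.eq_s
  have e1 := (dispGroup_commute_lp_self (lp_c_mem₃ (L := L) x y u)).eq
  have e2 : L.E x y u = L.mul u (L.c x y u) := by
    have := congrArg (fun f : Equiv.Perm Q => f L.one) e1
    simpa [E_apply, L.mul_one] using this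
  have e3 : Commute (L.lp (h (L.c x y u))) (L.lp (h u)) := by
    rw [apply_c₁ hh]
    exact dispGroup_commute_lp (lp_c_mem₃ _ _ _) hh
  rw [inn_apply_comm (L.E_mem x y) hh, e2, L.apply_mul, hk]
  simpa [L.mul_one] using congrArg (fun f : Equiv.Perm Q => f L.one) e3.eq

theorem apply_c₃_of {h : Equiv.Perm Q} (hh : h ∈ L.inn) {u : Q}
    (hC : ∀ k ∈ L.cen, Commute h k)
    (he : ∀ g ∈ L.inn, Commute g (L.lp (L.s h u) * L.lp (L.s h u))) (x y : Q) :
    h (L.c x y u) = L.c x y (h u) := by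
  apply apply_c₃_of_fixes hh
  set k := L.D h u with hk
  have hkm : k ∈ L.inn := D_mem hh u
  set p := L.lp (L.s h u) with hp
  have hpm : p ∈ L.dispGroup u := lp_s_mem hh u
  have hpu : L.lp (h u) = p * L.lp u := lp_apply_eq_s_mul hh u
  have e1 : L.lp (h u) * k = h * L.lp u * h⁻¹ := by rw [hk, D]; group
  have e2 : (L.lp (h u) * k) * (L.lp (h u) * k) = L.lp u * L.lp u := by
    have := (hC _ (lp_sq_mem_cen u)).eq
    calc _ = h * (L.lp u * L.lp u) * h⁻¹ := by rw [e1]; group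
      _ = _ := by rw [this, mul_inv_cancel_right]
  set z := (p * p)⁻¹ with hz
  have hzk : ∀ g ∈ L.inn, Commute g z := fun g hg => (he g hg).inv_right
  have hzu : z ∈ L.dispGroup u := inv_mem (mul_mem hpm hpm)
  have e3 : k * L.lp (h u) * k = z * L.lp (h u) := by
    have c := (dispGroup_commute_lp_self hpm).inv_left.eq
    calc k * L.lp (h u) * k = (L.lp (h u))⁻¹ * ((L.lp (h u) * k) * (L.lp (h u) * k)) := by group
      _ = (L.lp u)⁻¹ * (p⁻¹ * L.lp u) * L.lp u := by rw [e2, hpu]; group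
      _ = _ := by rw [c, hz, hpu]; group
  have e4 : ∀ j ∈ L.inn, SemiconjBy (L.lp (j u)) k (z * k⁻¹) := by
    intro j hj
    have s0 : SemiconjBy (L.lp (h u)) k (z * k⁻¹) := by
      rw [SemiconjBy, ← ((hzk _ (inv_mem hkm)).eq), mul_assoc, ← e3]; group
    have := semiconjBy_orbit (h := j * h⁻¹)
      (fun g hg => (hzk g hg).mul_right (inn_commute hg (inv_mem hkm)))
      (fun g hg => inn_commute hg hkm) (mul_mem hj (inv_mem hh)) s0
    simpa using this
  have e5 : Commute (L.lp (h (L.c x y u))) k := by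
    rw [apply_c₁ hh]
    have m := lp_c_mem₃ (L := L) (h x) y u
    have s1 : Commute (L.lp (L.c (h x) y u)) (z * k⁻¹) := by
      rw [c_eq_s_E, lp_s (L.E_mem _ _)]
      exact (e4 _ (L.E_mem _ _)).mul_left (e4 1 (one_mem _)).inv_symm_left
    have s2 := (dispGroup_commute m hzu).inv_right.mul_right s1
    simpa using s2
  have := congrArg (fun f : Equiv.Perm Q => f L.one) e5.eq
  simpa [L.mul_one, apply_one hkm] using this.symm

/-- Equivariance of `c` in its third argument under middle inner mappings. -/
theorem apply_c₃_M (x y u z w : Q) : L.M z w (L.c x y u) = L.c x y (L.M z w u) :=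
  apply_c₃_of (L.M_mem z w) (fun _ hk => M_commute_cen z w hk)
    (fun _ hg => lp_c_sq_commute hg z u w) x y

theorem apply_c₃_V (x y u z w : Q) : (L.V z w)⁻¹ (L.c x y u) = L.c x y ((L.V z w)⁻¹ u) := by
  refine apply_c₃_of (inv_mem (L.V_mem z w)) (fun _ hk => (V_commute_cen z w hk).inv_left)
    (fun _ hg => ?_) x y
  rw [← c_eq_s_V]
  exact lp_c_sq_commute hg _ _ _

theorem s_c₃ {h : Equiv.Perm Q} (hh : h ∈ L.inn) {x y u : Q}
    (heq : h (L.c x y u) = L.c x y (h u)) :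
    L.s h (L.c x y u) = L.c x y (L.s h u) := by
  simp only [c_eq_s_E] at heq ⊢
  exact s_s_comm (L.E_mem x y) hh heq

/-! ### Values of `c` with an argument that is a value of `c` -/

theorem c_c_left₁ (x y u z w : Q) : L.c (L.c x y u) z w = L.c (L.c x z w) y u := by
  rw [c_eq_s_V (L.c x y u), s_c₁ (inv_mem (L.V_mem z w)), ← c_eq_s_V]

theorem c_c_left₂ (x y u z w : Q) : L.c (L.c x y u) z w = L.c x (L.c y z w) u := by
  rw [c_eq_s_V (L.c x y u), s_c₂ (inv_mem (L.V_mem z w)), ← c_eq_s_V]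

theorem c_c_left₃ (x y u z w : Q) : L.c (L.c x y u) z w = L.c x y (L.c u z w) := by
  rw [c_eq_s_V (L.c x y u), s_c₃ (inv_mem (L.V_mem z w)) (apply_c₃_V x y u z w), ← c_eq_s_V]

theorem c_c_mid₁ (x y u z w : Q) : L.c z (L.c x y u) w = L.c (L.c z x w) y u :=
  s_c₁ (L.M_mem z w) x y u

theorem c_c_mid₂ (x y u z w : Q) : L.c z (L.c x y u) w = L.c x (L.c z y w) u :=
  s_c₂ (L.M_mem z w) x y u

theorem c_c_mid₃ (x y u z w : Q) : L.c z (L.c x y u) w = L.c x y (L.c z u w) :=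
  s_c₃ (L.M_mem z w) (apply_c₃_M x y u z w)

variable (L) in
/-- The iterated value `c (c x y u) z w`. -/
def W (x y u z w : Q) : Q := L.c (L.c x y u) z w

theorem W_swap (x y u z w : Q) : L.W x y u z w = L.W x z w y u := c_c_left₁ x y u z w

theorem W_flip (x y u z w : Q) : L.W x y u z w = L.W y x w z u := by
  have h := (c_c_mid₁ (L := L) y z w x u).symm.trans (c_c_mid₂ y z w x u)
  rwa [c_c_mid₁] at h

theorem W_turn (x y u z w : Q) : L.W x y u z w = L.W y z x w u := by
  have h := (c_c_mid₁ (L := L) y z w x u).symm.trans (c_c_mid₃ y z w x u)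
  rwa [← c_c_left₃] at h

theorem c_one_left {L : LoopStr Q} (y u : Q) : L.c L.one y u = L.one := by
  apply L.eq_s
  simp [M, L.lp_one, L.one_mul]

theorem c_self (x u : Q) : L.c x x u = L.one := by
  apply L.eq_s
  rw [M_self, L.one_mul]

theorem c_self_apply {h : Equiv.Perm Q} (hh : h ∈ L.inn) (x u : Q) :
    L.c x (h x) u = L.one := by
  rw [← apply_c₂ hh, c_self, apply_one hh]

theorem c_apply_self {h : Equiv.Perm Q} (hh : h ∈ L.inn) (x u : Q) :
    L.c (h x) x u = L.one := by
  rw [← apply_c₁ hh, c_self, apply_one hh]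

theorem W_self_apply {h : Equiv.Perm Q} (hh : h ∈ L.inn) (x u z w : Q) :
    L.W x (h x) u z w = L.one := by
  rw [W, c_self_apply hh, c_one_left]

theorem W_apply_self {h : Equiv.Perm Q} (hh : h ∈ L.inn) (x u z w : Q) :
    L.W (h x) x u z w = L.one := by
  rw [W, c_apply_self hh, c_one_left]

theorem W_self (x u z w : Q) : L.W x x u z w = L.one := by
  rw [W, c_self, c_one_left]

theorem lp_W_sq (x y u z w : Q) : L.lp (L.W x y u z w) * L.lp (L.W x y u z w) = 1 := by
  rw [W, c_eq_s_V (L.c x y u)]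
  exact lp_s_c_sq (inv_mem (L.V_mem z w)) x y u

theorem lp_W_inv (x y u z w : Q) : (L.lp (L.W x y u z w))⁻¹ = L.lp (L.W x y u z w) :=
  inv_eq_of_mul_eq_one_right (lp_W_sq x y u z w)

theorem apply_W₂ {h : Equiv.Perm Q} (hh : h ∈ L.inn) (x y u z w : Q) :
    h (L.W x y u z w) = L.W x (h y) u z w := by
  rw [W, apply_c₁ hh, apply_c₂ hh]; rfl

theorem lp_W_mem₁ (x y u z w : Q) : L.lp (L.W x y u z w) ∈ L.dispGroup x := by
  rw [W, c_c_left₂]; exact lp_c_mem₁ _ _ _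

theorem lp_W_mem₂ (x y u z w : Q) : L.lp (L.W x y u z w) ∈ L.dispGroup y := by
  rw [W_flip]; exact lp_W_mem₁ _ _ _ _ _

theorem lp_W_mem₃ (x y u z w : Q) : L.lp (L.W x y u z w) ∈ L.dispGroup u := by
  rw [W_flip, W_turn, W_swap]; exact lp_W_mem₂ _ _ _ _ _

theorem lp_W_mem₄ (x y u z w : Q) : L.lp (L.W x y u z w) ∈ L.dispGroup z :=
  lp_c_mem₂ _ _ _

theorem lp_W_mem₅ (x y u z w : Q) : L.lp (L.W x y u z w) ∈ L.dispGroup w :=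
  lp_c_mem₃ _ _ _

/-! ### Equivariance of `c` in the third argument -/

theorem lp_conj_lp (t u : Q) :
    (L.lp t)⁻¹ * L.lp u * L.lp t = L.lp (L.T t u) * L.D (L.T t) u * L.M u t := by
  have h1 := L.conj_lp (L.T t) u
  have h2 := L.lp_mul_rp u t
  have h3 := (inn_commute (L.M_mem u t) (L.T_mem t)).eq
  have h4 : (L.lp t)⁻¹ * L.lp u * L.lp t * L.T t =
      L.lp (L.T t u) * L.D (L.T t) u * L.M u t * L.T t := by
    calc _ = (L.lp t)⁻¹ * (L.lp u * L.rp t) := by rw [L.rp_eq]; group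
      _ = L.T t * L.lp u * L.M u t := by rw [h2, T]; group
      _ = _ := by rw [h1, mul_assoc _ (L.T t), ← h3]; group
  exact mul_right_cancel h4

theorem M_fixes_of {L : LoopStr Q} {x y u : Q} (h : L.c x y u = L.one) : L.M x u y = y := by
  rw [M_apply, h, L.one_mul]

theorem mul_assoc_of {x y u : Q} (h : L.c x y u = L.one) :
    L.mul x (L.mul y u) = L.mul (L.mul x y) u := by
  rw [mul_assoc_c, h, L.one_mul]

theorem apply_c₃_T (x y u t : Q) : L.T t (L.c x y u) = L.c x y (L.T t u) := by
  apply apply_c₃_of_fixes (L.T_mem t)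
  have hT := L.T_mem t
  have hf := apply_c₁ hT x y u
  have hfm : L.lp (L.T t (L.c x y u)) ∈ L.dispGroup u := by rw [hf]; exact lp_c_mem₃ _ _ _
  set f := L.T t (L.c x y u) with hfdef
  have e1 : L.M u t f = f := by
    apply M_fixes_of
    rw [hf, c_c_mid₁]
    change L.W u (L.T t x) t y u = L.one
    rw [W_turn, W_swap, W_turn, W_swap]
    exact W_self _ _ _ _
  have e2 : L.c (L.c x y u) t (L.T t u) = L.one := by
    change L.W x y u t (L.T t u) = L.one
    rw [W_turn, W_turn, W_turn]
    exact W_apply_self hT _ _ _ _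
  have e3 : L.c t f (L.T t u) = L.one := by
    rw [hf, c_c_mid₁]
    change L.W t (L.T t x) (L.T t u) y u = L.one
    rw [W_turn, W_turn, W_turn]
    exact W_self_apply hT _ _ _ _
  have e4 : L.mul u (L.mul t f) = L.mul t (L.mul (L.T t u) f) := by
    have a1 := congrArg (fun g : Equiv.Perm Q => g t)
      (dispGroup_commute_lp_self (lp_c_mem₃ (L := L) x y u)).eq
    have a2 := congrArg (fun g : Equiv.Perm Q => g L.one)
      (dispGroup_commute_lp hfm hT).eq
    simp only [Equiv.Perm.mul_apply, lp_apply, L.mul_one] at a1 a2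
    rw [← a2, mul_assoc_of e3, hfdef, L.mul_T, ← mul_assoc_of e2, L.mul_T, a1]
  have e5 := congrArg (fun g : Equiv.Perm Q => g f) (L.lp_conj_lp t u)
  simp only [Equiv.Perm.mul_apply, e1] at e5
  rw [Equiv.Perm.inv_eq_iff_eq] at e5
  simp only [lp_apply] at e5
  rw [e4] at e5
  exact (L.mul_left_cancel' (L.mul_left_cancel' e5)).symm

theorem T_mul {L : LoopStr Q} (a b : Q) : L.T (L.mul a b) =
    L.E a b * L.T b * (L.M a b)⁻¹ * L.T a * (L.V a b)⁻¹ := by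
  rw [T, M, E, V, T, T]; group

/-- Equivariance of `c` in its third argument. -/
theorem apply_c₃ {h : Equiv.Perm Q} (hh : h ∈ L.inn) (x y u : Q) :
    h (L.c x y u) = L.c x y (h u) := by
  let K : Subgroup (Equiv.Perm Q) :=
    { carrier := {g | ∀ u, g (L.c x y u) = L.c x y (g u)}
      mul_mem' := fun {a b} ha hb u => by rw [Equiv.Perm.mul_apply, hb u, ha]; rfl
      one_mem' := fun _ => rfl
      inv_mem' := fun {a} ha u => by
        rw [Equiv.Perm.inv_eq_iff_eq, ha]; simp }
  have hT : ∀ t, L.T t ∈ K := fun t u => apply_c₃_T x y u t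
  have hM : ∀ z w, L.M z w ∈ K := fun z w u => apply_c₃_M x y u z w
  have hV : ∀ z w, L.V z w ∈ K := fun z w => by
    rw [← inv_mem_iff]
    exact fun u => apply_c₃_V x y u z w
  have hE : ∀ a b, L.E a b ∈ K := fun a b => by
    have e : L.E a b = L.T (L.mul a b) * L.V a b * (L.T a)⁻¹ * L.M a b * (L.T b)⁻¹ := by
      rw [T_mul]; group
    rw [e]
    exact mul_mem (mul_mem (mul_mem (mul_mem (hT _) (hV _ _)) (inv_mem (hT _))) (hM _ _))
      (inv_mem (hT _))
  have hle : L.inn ≤ K := by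
    refine L.inn_le_closure.trans ?_
    rw [Subgroup.closure_le]
    rintro _ ((⟨x, rfl⟩ | ⟨p, rfl⟩) | ⟨p, rfl⟩)
    exacts [hT x, hE _ _, hV _ _]
  exact hle hh u

theorem s_c₃' {h : Equiv.Perm Q} (hh : h ∈ L.inn) (x y u : Q) :
    L.s h (L.c x y u) = L.c x y (L.s h u) := s_c₃ hh (apply_c₃ hh x y u)

theorem apply_s_c {g h : Equiv.Perm Q} (hg : g ∈ L.inn) (hh : h ∈ L.inn) (x y u : Q) :
    h (L.s g (L.c x y u)) = L.s g (h (L.c x y u)) := by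
  rw [s_c₁ hg, apply_c₂ hh, apply_c₂ hh, s_c₁ hg]

theorem apply_W₃ {h : Equiv.Perm Q} (hh : h ∈ L.inn) (x y u z w : Q) :
    h (L.W x y u z w) = L.W x y (h u) z w := by
  rw [W, apply_c₁ hh, apply_c₃ hh]; rfl

/-! ### The inner mapping `T` at a product -/

theorem T_fixes {x q : Q} (hq : L.lp q ∈ L.dispGroup x) : L.T x q = q := by
  have := congrArg (fun g : Equiv.Perm Q => g L.one) (T_commute hq).eq
  simpa only [Equiv.Perm.mul_apply, lp_apply, L.mul_one, apply_one (L.T_mem x)] using this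

theorem lp_mul_of_mem {x a b : Q} (ha : L.lp a ∈ L.dispGroup x) (hb : L.lp b ∈ L.dispGroup x) :
    L.lp (L.mul a b) = L.lp a * L.lp b := by
  rw [dispGroup_eq_lp (mul_mem ha hb), Equiv.Perm.mul_apply, lp_apply, lp_apply, L.mul_one]

theorem lp_T_mul (a b x z w : Q) : L.lp (L.T (L.mul a b) (L.c x z w)) =
    L.lp (L.W a x b z w) * L.lp (L.T a (L.T b (L.c x z w))) := by
  have ha := L.T_mem a
  have hb := L.T_mem b
  have hX : L.T a (L.T b (L.c x z w)) = L.c (L.T a (L.T b x)) z w := by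
    rw [apply_c₁ hb, apply_c₁ ha]
  have hmem : L.lp (L.T a (L.T b (L.c x z w))) ∈ L.dispGroup x := by
    rw [hX, ← dispGroup_orbit (mul_mem ha hb) x]
    exact lp_c_mem₁ _ _ _
  have hT : L.T (L.mul a b) (L.c x z w) =
      (L.M a b)⁻¹ ((L.V a b)⁻¹ (L.E a b (L.T a (L.T b (L.c x z w))))) := by
    have e1 := (inn_commute (mul_mem (L.E_mem a b) hb) (inv_mem (L.M_mem a b))).eq
    have e2 := (inn_commute (mul_mem (L.E_mem a b) (mul_mem hb ha)) (inv_mem (L.V_mem a b))).eq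
    have : L.T (L.mul a b) = (L.M a b)⁻¹ * ((L.V a b)⁻¹ * (L.E a b * (L.T a * L.T b))) := by
      rw [T_mul, e1, (inn_commute ha hb).eq, ← e2]; group
    rw [this]; rfl
  have hW : L.W a (L.T a (L.T b x)) b z w = L.W a x b z w := by
    rw [← apply_W₂ ha, ← apply_W₂ hb, T_fixes (lp_W_mem₃ _ _ _ _ _),
      T_fixes (lp_W_mem₁ _ _ _ _ _)]
  have hV : (L.V a b)⁻¹ (L.E a b (L.T a (L.T b (L.c x z w)))) = L.T a (L.T b (L.c x z w)) := by
    rw [hX, E_apply]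
    have e1 : L.c (L.c (L.T a (L.T b x)) z w) a b = L.c a b (L.c (L.T a (L.T b x)) z w) := by
      rw [← c_c_left₃]
      exact ((W_swap _ _ _ _ _).trans <| (W_turn _ _ _ _ _).trans <| (W_flip _ _ _ _ _).trans <|
        (W_turn _ _ _ _ _).trans (W_flip _ _ _ _ _)).symm
    rw [← lp_apply, ← Equiv.Perm.mul_apply, (V_commute b (lp_c_mem₁ _ _ _)).inv_left.eq,
      Equiv.Perm.mul_apply, V_inv_apply, ← e1, ← lp_apply L, ← Equiv.Perm.mul_apply]
    have := lp_W_sq (L := L) (L.T a (L.T b x)) z w a b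
    rw [W] at this
    rw [this]; rfl
  rw [hT, hV]
  have hm : L.lp (L.W a x b z w) ∈ L.dispGroup x := lp_W_mem₂ _ _ _ _ _
  rw [← lp_mul_of_mem hm hmem, M_inv_apply]
  have e2 : L.c a (L.T a (L.T b (L.c x z w))) b = L.W a x b z w := by
    rw [hX, c_c_mid₁, ← hW]; rfl
  rw [e2, lp_W_inv]; rfl

/-! ### Orbits of the subgroup commuting with right translations -/

variable (L) in
/-- Lying in the same orbit of `L.cen`. -/
def CenRel (a b : Q) : Prop := ∃ k ∈ L.cen, k a = b

theorem CenRel.symm {L : LoopStr Q} {a b : Q} : L.CenRel a b → L.CenRel b a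
  | ⟨k, hk, e⟩ => ⟨k⁻¹, inv_mem hk, by rw [← e]; simp⟩

theorem CenRel.trans {L : LoopStr Q} {a b d : Q} : L.CenRel a b → L.CenRel b d → L.CenRel a d
  | ⟨k, hk, e⟩, ⟨l, hl, f⟩ => ⟨l * k, mul_mem hl hk, by rw [Equiv.Perm.mul_apply, e, f]⟩

theorem CenRel.map {a b : Q} {g : Equiv.Perm Q} (hg : g ∈ L.mlt) :
    L.CenRel a b → L.CenRel (g a) (g b)
  | ⟨k, hk, e⟩ => ⟨g * k * g⁻¹, cen_conj hg hk, by rw [← e]; simp⟩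

theorem cenRel_apply {L : LoopStr Q} {k : Equiv.Perm Q} (hk : k ∈ L.cen) (z : Q) :
    L.CenRel (k z) z :=
  CenRel.symm ⟨k, hk, rfl⟩

theorem cenRel_inv (x z : Q) : L.CenRel ((L.lp x)⁻¹ z) (L.lp x z) :=
  ⟨L.lp x * L.lp x, lp_sq_mem_cen x, by simp⟩

theorem cenRel_D {h : Equiv.Perm Q} (hh : h ∈ L.inn) (x z : Q) :
    L.CenRel (L.D h x (L.lp (h x) (L.D h x z))) (L.lp (h x) z) := by
  refine CenRel.trans ?_ (cenRel_inv (h x) z)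
  have e : L.lp (h x) * L.D h x * (L.lp (h x) * L.D h x) = h * (L.lp x * L.lp x) * h⁻¹ := by
    rw [D]; group
  have hc : h * (L.lp x * L.lp x) * h⁻¹ ∈ L.cen := cen_conj hh.1 (lp_sq_mem_cen x)
  have h1 := CenRel.map (inv_mem (L.lp_mem (h x))) (cenRel_apply hc z)
  rw [← e] at h1
  simpa using h1

theorem cenRel_D' {h : Equiv.Perm Q} (hh : h ∈ L.inn) (x z : Q) :
    L.CenRel (L.D h x (L.lp x (L.D h x z))) (L.lp x z) := by
  have hk := D_mem (L := L) hh x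
  have e : ∀ z, L.lp x z = h⁻¹ (L.lp (h x) (L.D h x (h z))) := fun z => by
    have := congrArg (fun f : Equiv.Perm Q => h⁻¹ (f z)) (L.conj_lp h x)
    simpa using this
  have h1 := CenRel.map (inv_mem hh.1) (cenRel_D hh x (L.D h x (h z)))
  rw [e (L.D h x z), e z, inn_apply_comm hk (inv_mem hh), inn_apply_comm hh hk]
  exact h1

theorem cenRel_D_self {h : Equiv.Perm Q} (hh : h ∈ L.inn) (x : Q) : L.CenRel (L.D h x x) x := by
  have := cenRel_D' hh x L.one
  rwa [apply_one (D_mem hh x), lp_apply, L.mul_one] at this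

theorem cenRel_s {h : Equiv.Perm Q} (hh : h ∈ L.inn) (x : Q) :
    L.CenRel (L.s h x) (L.lp (h x) x) := by
  have e : L.lp (h x) ((L.lp x)⁻¹ L.one) = L.s h x := by
    rw [← Equiv.Perm.mul_apply, ← lp_s hh, lp_apply, L.mul_one]
  have := CenRel.map (L.lp_mem (h x)) (cenRel_inv x L.one)
  rwa [e, lp_apply L x, L.mul_one] at this

theorem cenRel_D_s {h : Equiv.Perm Q} (hh : h ∈ L.inn) (x : Q) :
    L.CenRel (L.D h x (L.s h x)) (L.s h x) := by
  have hk := D_mem (L := L) hh x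
  refine (CenRel.map hk.1 (cenRel_s hh x)).trans (CenRel.trans ?_ (cenRel_s hh x).symm)
  have h1 := cenRel_D hh x ((L.D h x)⁻¹ x)
  have e : L.D h x ((L.D h x)⁻¹ x) = x := by simp
  rw [e] at h1
  refine h1.trans (CenRel.map (L.lp_mem _) ?_)
  have h2 := CenRel.map (inv_mem hk).1 (cenRel_D_self hh x)
  simp only [← Equiv.Perm.mul_apply, inv_mul_cancel, Equiv.Perm.one_apply] at h2
  exact h2.symm

theorem lp_conj_rel (x t z : Q) : L.CenRel (L.lp x (L.lp t (L.lp x (L.lp t z))))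
    (L.lp x (L.lp (L.T t x) (L.D (L.T t) x (L.M x t z)))) := by
  have e := congrArg (fun f : Equiv.Perm Q => f z) (lp_conj_lp (L := L) t x)
  simp only [Equiv.Perm.mul_apply] at e
  rw [← e]
  exact CenRel.map (L.lp_mem x) (cenRel_inv t _).symm

theorem cenRel_s_T_word (x t : Q) :
    L.CenRel (L.s (L.T t) x) (L.lp x (L.lp t (L.lp x (L.lp t L.one)))) := by
  have h1 := lp_conj_rel (L := L) x t L.one
  have c := congrArg (fun f : Equiv.Perm Q => f L.one)
    (lp_orbit_commute (L.T_mem t) (one_mem L.inn) x).eq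
  simp only [Equiv.Perm.mul_apply, Equiv.Perm.one_apply, lp_apply, L.mul_one] at c
  rw [apply_one (L.M_mem x t), apply_one (D_mem (L.T_mem t) x), lp_apply L (L.T t x),
    L.mul_one, lp_apply L x (L.T t x), ← c] at h1
  exact (cenRel_s (L.T_mem t) x).trans h1.symm

theorem cenRel_word_s_T (x t : Q) :
    L.CenRel (L.lp x (L.lp t (L.lp x (L.lp t (L.s (L.T t) x))))) L.one := by
  have hT := L.T_mem t
  have e1 : L.M x t (L.s (L.T t) x) = L.s (L.T t) x := by
    have := congrArg (fun f : Equiv.Perm Q => f L.one) (M_commute t (lp_s_mem hT x)).eq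
    simpa only [Equiv.Perm.mul_apply, lp_apply, L.mul_one, apply_one (L.M_mem x t)] using this
  have h1 := lp_conj_rel (L := L) x t (L.s (L.T t) x)
  rw [e1] at h1
  refine h1.trans ((CenRel.map (L.lp_mem x) (CenRel.map (L.lp_mem _)
    ((cenRel_D_s hT x).trans (cenRel_s hT x)))).trans ?_)
  have c := (lp_orbit_commute hT (one_mem L.inn) x).eq
  simp only [Equiv.Perm.one_apply] at c
  refine (CenRel.map (L.lp_mem x) (cenRel_apply (lp_sq_mem_cen (L.T t x)) x)).trans ?_
  have := cenRel_apply (lp_sq_mem_cen (L := L) x) L.one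
  rwa [Equiv.Perm.mul_apply, lp_apply L x L.one, L.mul_one] at this

theorem cenRel_s_T (x t : Q) : L.CenRel (L.s (L.T t) x) (L.s (L.T x) t) := by
  refine CenRel.trans ?_ (cenRel_s_T_word t x).symm
  have h1 := cenRel_word_s_T (L := L) x t
  have i := fun a => inv_mem (L.lp_mem a)
  have h2 := CenRel.map (i t) (CenRel.map (i x) (CenRel.map (i t) (CenRel.map (i x) h1)))
  simp only [← Equiv.Perm.mul_apply, inv_mul_cancel,
    Equiv.Perm.one_apply, inv_mul_cancel_left] at h2
  refine h2.trans ?_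
  simp only [Equiv.Perm.mul_apply]
  refine (cenRel_inv t _).trans (CenRel.map (L.lp_mem t) ?_)
  refine (cenRel_inv x _).trans (CenRel.map (L.lp_mem x) ?_)
  exact (cenRel_inv t _).trans (CenRel.map (L.lp_mem t) (cenRel_inv x _))

theorem c_congr₁ {L : LoopStr Q} {a b : Q} (hab : L.CenRel a b) (y u : Q) :
    L.c a y u = L.c b y u := by
  obtain ⟨k, hk, rfl⟩ := hab
  have : L.M (k a) u = L.M a u := by
    have e := (inv_mem hk).2 u
    calc L.M (k a) u = (L.lp a)⁻¹ * (k⁻¹ * (L.rp u)⁻¹) * k * L.lp a * L.rp u := by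
          rw [M, ← cen_mul_lp hk]; group
      _ = _ := by rw [e.inv_right.eq, M]; group
  rw [c, c, this]

theorem c_congr₂ {a b : Q} (hab : L.CenRel a b) (x u : Q) : L.c x a u = L.c x b u := by
  obtain ⟨k, hk, rfl⟩ := hab
  have hM := L.M_mem x u
  have e1 : L.lp (L.c x (k a) u) = k * L.lp (L.c x a u) * k⁻¹ := by
    have e := congrArg (fun f : Equiv.Perm Q => f a) (M_commute_cen (L := L) x u hk).eq
    simp only [Equiv.Perm.mul_apply] at e
    rw [c, c, lp_s hM, lp_s hM, e, ← cen_mul_lp hk, ← cen_mul_lp hk]; group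
  have e2 := (dispGroup_commute_lp_self (lp_c_mem₂ (L := L) x a u)).eq
  have e3 := (dispGroup_commute_lp_self (lp_c_mem₂ (L := L) x (k a) u)).eq
  have e4 : k = L.lp (k a) * (L.lp a)⁻¹ := by rw [← cen_mul_lp hk]; group
  apply L.lp_injective
  apply mul_left_cancel (a := L.lp (k a))
  rw [← e3, e1, ← cen_mul_lp hk]
  calc _ = k * (L.lp a * L.lp (L.c x a u)) * (L.lp a)⁻¹ * L.lp a := by group
    _ = k * (L.lp (L.c x a u) * L.lp a) := by rw [e2]; group
    _ = _ := by group

/-- Displacements under `T` are symmetric in the first argument of `c`. -/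
theorem s_T_c₁ (x y u t : Q) : L.s (L.T t) (L.c x y u) = L.s (L.T x) (L.c t y u) := by
  rw [s_c₁ (L.T_mem t), s_c₁ (L.T_mem x), c_congr₁ (cenRel_s_T x t)]

/-- Displacements under `T` are symmetric in the second argument of `c`. -/
theorem s_T_c₂ (x y u t : Q) : L.s (L.T t) (L.c x y u) = L.s (L.T y) (L.c x t u) := by
  rw [s_c₂ (L.T_mem t), s_c₂ (L.T_mem y), c_congr₂ (cenRel_s_T y t)]

/-! ### Displacements of values of `c` under `T` -/

theorem T_s_T_c (x z u y : Q) : L.T y (L.s (L.T y) (L.c x z u)) = L.s (L.T y) (L.c x z u) := by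
  apply T_fixes
  rw [s_T_c₁, s_c₂ (L.T_mem x)]
  exact lp_c_mem₁ _ _ _

theorem T_T_c (x z u y : Q) : L.T y (L.T y (L.c x z u)) = L.c x z u := by
  have hT := L.T_mem y
  have h1 := T_s_T_c (L := L) x z u y
  apply L.lp_injective
  rw [lp_apply_eq_s_mul hT (L.T y (L.c x z u)), ← apply_s_c hT hT, h1, lp_apply_eq_s_mul hT,
    ← mul_assoc, lp_s_c_sq hT, _root_.one_mul]

theorem lp_T_T_c (a b x z u : Q) : L.lp (L.T a (L.T b (L.c x z u))) =
    L.lp (L.T a (L.s (L.T b) (L.c x z u))) * L.lp (L.s (L.T a) (L.c x z u)) *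
      L.lp (L.c x z u) := by
  have ha := L.T_mem a
  have hb := L.T_mem b
  rw [inn_apply_comm ha hb, lp_apply_eq_s_mul hb, lp_apply_eq_s_mul ha, apply_s_c hb ha,
    mul_assoc]

theorem lp_s_T_mul (a b x z u : Q) : L.lp (L.s (L.T (L.mul a b)) (L.c x z u)) =
    L.lp (L.W a x b z u) * L.lp (L.T a (L.s (L.T b) (L.c x z u))) *
      L.lp (L.s (L.T a) (L.c x z u)) := by
  rw [lp_s (L.T_mem _), lp_T_mul, lp_T_T_c]; group

theorem D_T_c_apply (x y v t z : Q) :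
    L.D (L.T t) (L.c x y v) z = L.mul (L.W x y v t z) z := by
  have hT := L.T_mem t
  set F := L.c x y v with hF
  have hψ : L.W x y v t z = L.c F t z := rfl
  have ho : L.c F z t = L.c t F z := by
    rw [hF, c_c_mid₁]
    exact (W_swap _ _ _ _ _).trans <| (W_flip _ _ _ _ _).trans <| (W_turn _ _ _ _ _).trans <|
      (W_swap _ _ _ _ _).trans (W_flip _ _ _ _ _)
  have hsq : L.lp (L.c F z t) * L.lp (L.c F z t) = 1 := lp_W_sq x y v z t
  have hot : L.c t (L.T t F) z = L.c F z t := by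
    rw [← apply_c₂ hT, T_fixes (lp_c_mem₁ _ _ _), ho]
  rw [hψ]
  set ψ := L.c F t z
  set o := L.c F z t
  have hot' : L.lp o ∈ L.dispGroup t := lp_c_mem₃ _ _ _
  have hoF : L.lp o ∈ L.dispGroup F := lp_c_mem₁ _ _ _
  have hψt : L.lp ψ ∈ L.dispGroup t := lp_c_mem₂ _ _ _
  have hψF : L.lp ψ ∈ L.dispGroup F := lp_c_mem₁ _ _ _
  have comm : ∀ {x : Q} {a b : Equiv.Perm Q}, Commute a b → ∀ z, a (b z) = b (a z) :=
    fun h z => congrArg (fun f : Equiv.Perm Q => f z) h.eq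
  have hoo : ∀ w, L.lp o (L.lp o w) = w := fun w => by
    rw [← Equiv.Perm.mul_apply, hsq]; rfl
  have e1 : L.lp F (L.lp t z) = L.lp ψ (L.lp o (L.lp t (L.lp (L.T t F) z))) := by
    have a1 := mul_assoc_c (L := L) F t z
    have a2 := mul_assoc_c (L := L) t (L.T t F) z
    rw [hot, L.mul_T] at a2
    simp only [lp_apply] at hoo ⊢
    rw [a1, a2, hoo]
  have e2 : (L.M F t)⁻¹ z = L.lp o z := by
    rw [M_inv_apply, inv_eq_of_mul_eq_one_right hsq]
  have e3 := congrArg (fun f : Equiv.Perm Q => f ((L.M F t)⁻¹ z)) (lp_conj_lp (L := L) t F)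
  simp only [Equiv.Perm.mul_apply] at e3
  rw [← Equiv.Perm.mul_apply (L.M F t), mul_inv_cancel, Equiv.Perm.one_apply, e2,
    Equiv.Perm.inv_eq_iff_eq, ← comm (x := t) (dispGroup_commute_lp_self hot'),
    ← comm (x := t) (dispGroup_commute_lp_self hoF), e1,
    comm (x := t) (dispGroup_commute hψt hot'), hoo,
    comm (x := t) (dispGroup_commute_lp_self hψt),
    comm (x := t) (dispGroup_commute_lp hψF hT)] at e3
  exact ((L.lp _).injective ((L.lp t).injective e3)).symm

/-! ### Products of translations conjugated by a right translation -/

theorem M_mul_D_E (x y u : Q) :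
    L.M (L.mul x y) u * L.D (L.E x y) u * L.M (L.c x y u) u =
      L.D (L.M x u) y * L.M x u * L.M y u := by
  have hE := L.E_mem x y
  have hx := L.M_mem x u
  have hy := L.M_mem y u
  have hxy := L.M_mem (L.mul x y) u
  have hf := L.M_mem (L.c x y u) u
  have hD := D_mem (L := L) hE u
  have hD' := D_mem (L := L) hx y
  set f := L.c x y u with hfd
  have hfx : L.lp f ∈ L.dispGroup x := lp_c_mem₁ _ _ _
  have hfxy : L.lp f ∈ L.dispGroup (L.mul x y) := lp_c_mem_mul _ _ _
  have h1 : (L.rp u)⁻¹ * (L.lp x * L.lp y) * L.rp u =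
      L.lp f * L.lp (L.mul x y) * L.E x y * (L.D (L.M x u) y * L.M x u * L.M y u) := by
    have e1 : L.M x u * L.lp y = L.lp f * L.lp y * L.D (L.M x u) y * L.M x u := by
      rw [L.conj_lp, lp_apply_eq_s_mul hx]; rfl
    have e2 := (dispGroup_commute_lp_self hfx).eq
    calc _ = (L.rp u)⁻¹ * L.lp x * L.rp u * ((L.rp u)⁻¹ * L.lp y * L.rp u) := by group
      _ = L.lp x * (L.M x u * L.lp y) * L.M y u := by
          rw [L.rp_conj_lp, L.rp_conj_lp]; group
      _ = L.lp f * (L.lp x * L.lp y) * (L.D (L.M x u) y * L.M x u * L.M y u) := by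
          rw [e1, ← mul_assoc (L.lp f), e2]; group
      _ = _ := by rw [L.lp_mul_lp]; group
  have h2 : (L.rp u)⁻¹ * (L.lp x * L.lp y) * L.rp u =
      L.lp f * L.lp (L.mul x y) * (L.M (L.mul x y) u * L.M f u * L.D (L.E x y) u * L.E x y) := by
    have e1 : L.E x y * L.rp u = L.lp f * L.rp u * L.D (L.E x y) u * L.E x y := by
      have a1 := (inn_commute hE (L.T_mem u)).eq
      have a2 := (inn_commute (L.T_mem u) hD).eq
      calc _ = L.E x y * L.lp u * L.T u := by rw [L.rp_eq]; group
        _ = L.lp f * L.lp u * L.D (L.E x y) u * (L.E x y * L.T u) := by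
            rw [L.conj_lp, lp_apply_eq_s_mul hE, ← c_eq_s_E, ← hfd]; group
        _ = L.lp f * L.lp u * (L.T u * L.D (L.E x y) u) * L.E x y := by
            rw [a1, a2]; group
        _ = _ := by rw [L.rp_eq]; group
    have e2 := (M_commute u hfxy).eq
    have e3 := (dispGroup_commute_lp_self hfxy).eq
    calc _ = (L.rp u)⁻¹ * L.lp (L.mul x y) * L.rp u * ((L.rp u)⁻¹ * (L.E x y * L.rp u)) := by
          rw [L.lp_mul_lp]; group
      _ = L.lp (L.mul x y) * L.M (L.mul x y) u * ((L.rp u)⁻¹ * L.lp f * L.rp u) *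
          L.D (L.E x y) u * L.E x y := by rw [L.rp_conj_lp, e1]; group
      _ = L.lp (L.mul x y) * (L.M (L.mul x y) u * L.lp f) * L.M f u *
          L.D (L.E x y) u * L.E x y := by rw [L.rp_conj_lp]; group
      _ = L.lp (L.mul x y) * L.lp f * (L.M (L.mul x y) u * L.M f u *
          L.D (L.E x y) u * L.E x y) := by rw [e2]; group
      _ = _ := by rw [← e3]
  have h3 := h1.symm.trans h2
  rw [mul_assoc (L.lp f * _), mul_left_cancel_iff] at h3
  rw [(inn_commute (mul_mem (mul_mem hxy hf) hD) hE).eq] at h3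
  have h4 := mul_left_cancel h3
  rw [h4, mul_assoc, mul_assoc, (inn_commute hf hD).eq]

theorem D_c_fixes_mul {h : Equiv.Perm Q} (hh : h ∈ L.inn) (x y u : Q) :
    L.D h (L.c x y u) (L.mul x y) = L.mul x y := by
  have hM := inv_mem (L.M_mem x u)
  have hs : ∀ y, L.lp (L.s (L.M x u)⁻¹ y) = (L.lp (L.c x y u))⁻¹ := fun y => by
    rw [lp_inv]
    congr 1
    apply L.eq_s
    rw [M_inv_apply, lp_inv]; rfl
  have heq : h (L.s (L.M x u)⁻¹ (L.mul x y)) = L.s (L.M x u)⁻¹ (h (L.mul x y)) :=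
    apply_s_of hM hh (fun _ hk => (M_commute_cen x u hk).inv_left) fun j _ => by
      rw [hs, inv_inv, inv_inv, M_apply]; rfl
  have e : L.s (L.M x u)⁻¹ (L.mul x y) = L.c x y u := by
    apply L.eq_s
    have a := congrArg (fun f : Equiv.Perm Q => f y) (semiconjBy_M (L := L) x u).eq
    have b := congrArg (fun f : Equiv.Perm Q => f y)
      (dispGroup_commute_lp_self (lp_c_mem₁ (L := L) x y u)).eq
    simp only [Equiv.Perm.mul_apply, lp_apply, M_apply] at a b
    rw [← a, b]
  rw [← e]
  exact D_s_fixes hM hh heq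

theorem dispGroup_ext {z : Q} {a b : Equiv.Perm Q} (ha : a ∈ L.dispGroup z)
    (hb : b ∈ L.dispGroup z) (h : a z = b z) : a = b := by
  rw [dispGroup_eq_lp ha, dispGroup_eq_lp hb] at h ⊢
  rw [L.mul_right_cancel' h]

/-! ### Triviality of iterated values of `c` -/

theorem D_E_s_T_apply (x y t v z : Q) :
    L.D (L.E x y) (L.s (L.T t) v) z = L.mul (L.W x y v t z) z := by
  have hE := L.E_mem x y
  have hT := L.T_mem t
  have heq : L.T t (L.s (L.E x y) v) = L.s (L.E x y) (L.T t v) := by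
    rw [← c_eq_s_E, ← c_eq_s_E, apply_c₃ hT]
  rw [D_s_symm hE hT heq, ← c_eq_s_E, D_T_c_apply]

theorem lp_W_mul_lp_c (x y z t v : Q) :
    L.lp (L.W x y v t z) * L.lp (L.c (L.mul x y) z (L.s (L.T t) v)) =
      L.lp (L.c y z (L.s (L.T t) v)) * L.lp (L.W y x z t v) *
        L.lp (L.c x z (L.s (L.T t) v)) := by
  have ht := L.T_mem t
  have hy := L.T_mem y
  set σ := L.s (L.T t) v with hσ
  have hM := L.M_mem x σ
  set p := L.lp (L.c y z σ) with hp
  set q := L.lp (L.c x y σ) with hq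
  have comm : ∀ {x : Q} {a b : Equiv.Perm Q}, Commute a b → ∀ z, a (b z) = b (a z) :=
    fun h z => congrArg (fun f : Equiv.Perm Q => f z) h.eq
  have hW : L.W x y σ z σ = L.one := by
    rw [W_turn, W_turn, W_turn, W_self]
  have hpy : p ∈ L.dispGroup y := lp_c_mem₁ _ _ _
  have hqy : q ∈ L.dispGroup y := lp_c_mem₂ _ _ _
  have key := congrArg (fun f : Equiv.Perm Q => f z) (M_mul_D_E (L := L) x y σ)
  simp only [Equiv.Perm.mul_apply] at key
  have left : L.M (L.mul x y) σ (L.D (L.E x y) σ (L.M (L.c x y σ) σ z)) =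
      (L.lp (L.W x y v t z) * L.lp (L.c (L.mul x y) z σ)) z := by
    have hm : L.lp (L.W x y v t z) ∈ L.dispGroup (L.mul x y) := by
      rw [W, c_c_left₃]; exact lp_c_mem_mul _ _ _
    rw [M_fixes_of hW, D_E_s_T_apply, ← lp_apply L (L.W x y v t z) z,
      comm (x := x) (M_commute σ hm), M_apply]
    rfl
  have hMp : L.M x σ (L.c y z σ) = L.c y z σ := by
    apply M_fixes_of
    rw [c_c_mid₁]; exact hW
  have right : L.D (L.M x σ) y (L.M x σ (L.M y σ z)) =
      (p * (L.lp y)⁻¹ * q⁻¹ * L.lp (L.c x (L.mul y z) σ) * L.lp y) z := by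
    have e1 : L.D (L.M x σ) y (L.M x σ (L.M y σ z)) =
        (L.lp (L.M x σ y))⁻¹ (L.M x σ (L.mul y (L.M y σ z))) := by
      rw [L.apply_mul, ← lp_apply L (L.M x σ y)]
      simp only [← Equiv.Perm.mul_apply, inv_mul_cancel_left]
    have e2 : L.mul y (L.M y σ z) = L.mul (L.c y z σ) (L.mul y z) := by
      rw [M_apply]
      exact (comm (x := y) (dispGroup_commute_lp_self hpy) z).symm
    have e3 : L.M x σ (L.mul (L.c y z σ) (L.mul y z)) =
        L.mul (L.c y z σ) (L.M x σ (L.mul y z)) := by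
      rw [L.apply_mul, hMp, inn_apply_comm (D_mem hM _) hM, D_c_fixes_mul hM]
    have e4 : L.lp (L.M x σ y) = q * L.lp y := by
      rw [lp_apply_eq_s_mul hM]; rfl
    rw [e1, e2, e3, e4, M_apply]
    have c1 := (dispGroup_commute_lp_self hpy).inv_right
    have c2 := (dispGroup_commute hpy hqy).inv_right
    have : (q * L.lp y)⁻¹ * p = p * (L.lp y)⁻¹ * q⁻¹ := by
      rw [mul_inv_rev, mul_assoc, ← c2.eq, ← mul_assoc, ← c1.eq]
    rw [← this]; rfl
  have hΞ : L.lp (L.c x (L.mul y z) σ) =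
      L.lp (L.W y x z t v) * L.lp (L.T y (L.c x z σ)) * q := by
    have a1 : L.s (L.T z) (L.c x t v) = L.c x z σ := by
      rw [← s_T_c₂, s_c₃' ht]
    have a2 : L.s (L.T y) (L.c x t v) = L.c x y σ := by
      rw [← s_T_c₂, s_c₃' ht]
    rw [hσ, ← s_c₃' ht, s_T_c₂, lp_s_T_mul, a1, a2]
  set w := L.lp (L.W y x z t v) with hw
  set a := L.T y (L.c x z σ) with ha
  have hac : a = L.c (L.T y x) z σ := apply_c₁ hy _ _ _
  have hwx : w ∈ L.dispGroup x := lp_W_mem₂ _ _ _ _ _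
  have hwy : w ∈ L.dispGroup y := lp_W_mem₁ _ _ _ _ _
  have hax : L.lp a ∈ L.dispGroup x := by
    rw [hac, ← dispGroup_orbit hy]; exact lp_c_mem₁ _ _ _
  have hqx : q ∈ L.dispGroup x := lp_c_mem₁ _ _ _
  have hWa : L.c a z y = L.one := by
    rw [hac]
    change L.W _ _ _ _ _ = _
    rw [W_turn, W_self]
  have hconj : (L.lp y)⁻¹ (L.lp a (L.lp y z)) = L.lp (L.c x z σ) z := by
    have e := congrArg (fun f : Equiv.Perm Q => f z) (lp_conj_lp (L := L) y a)
    simp only [Equiv.Perm.mul_apply] at e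
    rw [e, M_fixes_of hWa, ha, T_T_c, apply_c₁ hy, D_c_fixes₂ hy]
  have hz : (L.lp (L.W x y v t z) * L.lp (L.c (L.mul x y) z σ)) z =
      (p * w * L.lp (L.c x z σ)) z := by
    rw [← left, key, right, hΞ]
    have e1 : q⁻¹ * (w * L.lp a * q) = w * L.lp a := by
      rw [← (dispGroup_commute hqx (mul_mem hwx hax)).eq, inv_mul_cancel_left]
    have e2 : p * (L.lp y)⁻¹ * q⁻¹ * (w * L.lp a * q) * L.lp y =
        p * w * ((L.lp y)⁻¹ * L.lp a * L.lp y) := by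
      rw [mul_assoc (p * _), e1, ← mul_assoc, mul_assoc p,
        ← (dispGroup_commute_lp_self hwy).inv_right.eq]
      group
    rw [e2]
    simp only [Equiv.Perm.mul_apply]
    rw [hconj]
  exact dispGroup_ext (mul_mem (lp_W_mem₅ _ _ _ _ _) (lp_c_mem₂ _ _ _))
    (mul_mem (mul_mem (lp_c_mem₂ _ _ _) (lp_W_mem₃ _ _ _ _ _)) (lp_c_mem₂ _ _ _)) hz

theorem lp_W_mul_lp_T_c (x y z t v : Q) :
    L.lp (L.W x y v t z) * L.lp (L.W x t y z v) *
        L.lp (L.T x (L.c y z (L.s (L.T t) v))) =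
      L.lp (L.c y z (L.s (L.T t) v)) * L.lp (L.W y x z t v) := by
  have ht := L.T_mem t
  have e : L.lp (L.c (L.mul x y) z (L.s (L.T t) v)) =
      L.lp (L.W x t y z v) * L.lp (L.T x (L.c y z (L.s (L.T t) v))) *
        L.lp (L.c x z (L.s (L.T t) v)) := by
    rw [← s_c₃' ht, s_T_c₁, lp_s_T_mul, s_T_c₁ t z v y, s_T_c₁ t z v x, s_c₃' ht, s_c₃' ht]
  have h := lp_W_mul_lp_c (L := L) x y z t v
  rw [e, ← mul_assoc, ← mul_assoc] at h
  exact mul_right_cancel h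

theorem lp_W_mul_lp_T_c' (x y z t v : Q) :
    L.lp (L.W y t x z v) * L.lp (L.T x (L.c y z (L.s (L.T t) v))) =
      L.lp (L.W x t y z v) * L.lp (L.c y z (L.s (L.T t) v)) := by
  have ht := L.T_mem t
  have hx := L.T_mem x
  have hy := L.T_mem y
  have c1 : ∀ y', L.s (L.T y') (L.c t z v) = L.c y' z (L.s (L.T t) v) := fun y' => by
    rw [s_T_c₁, s_c₃' ht]
  have hW : L.W x t (L.T x y) z v = L.W x t y z v := by
    rw [← apply_W₃ hx, T_fixes (lp_W_mem₁ _ _ _ _ _)]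
  have e1 := lp_T_mul (L := L) x (L.T x y) t z v
  rw [hW, L.mul_T, lp_T_mul, inn_apply_comm hy hx, lp_T_T_c, lp_T_T_c, c1 y,
    c1 (L.T x y), ← apply_c₁ hx, T_T_c, ← mul_assoc, ← mul_assoc, ← mul_assoc, ← mul_assoc] at e1
  exact mul_right_cancel (mul_right_cancel e1)

theorem W_eq_one (x y u z w : Q) : L.W x y u z w = L.one := by
  have h1 := lp_W_mul_lp_T_c (L := L) x y w z u
  have h2 := lp_W_mul_lp_T_c' (L := L) x y w z u
  have e2 : L.W y z x w u = L.W x y u z w := (W_turn _ _ _ _ _).symm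
  have e3 : L.W y x w z u = L.W x y u z w := (W_flip _ _ _ _ _).symm
  rw [e2] at h2
  rw [e3] at h1
  set P := L.lp (L.W x y u z w)
  set P' := L.lp (L.W x z y w u)
  set B := L.lp (L.c y w (L.s (L.T z) u))
  have hP : P ∈ L.dispGroup w := lp_W_mem₅ _ _ _ _ _
  have hP' : P' ∈ L.dispGroup w := lp_W_mem₄ _ _ _ _ _
  have hB : B ∈ L.dispGroup w := lp_c_mem₂ _ _ _
  have hsq : P' * P' = 1 := lp_W_sq _ _ _ _ _
  have h3 : B * P = B := by
    rw [← h1, (dispGroup_commute hP hP').eq, mul_assoc, h2, ← mul_assoc, hsq, _root_.one_mul]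
  have hP1 : P = 1 := mul_eq_left.mp h3
  apply L.lp_injective
  rw [L.lp_one]
  exact hP1

/-! ### Values of `c` and associators are nuclear -/

theorem inNucleus_c (x y u : Q) : L.inNucleus (L.c x y u) := by
  have h1 : ∀ z w, L.c (L.c x y u) z w = L.one := W_eq_one x y u
  have h2 : ∀ z w, L.c z (L.c x y u) w = L.one := fun z w => by rw [c_c_mid₁]; exact W_eq_one ..
  have h3 : ∀ z w, L.c z w (L.c x y u) = L.one := fun z w => by
    rw [← c_c_left₃]; exact W_eq_one ..
  exact ⟨fun z w => (mul_assoc_of (h1 z w)).symm, fun z w => (mul_assoc_of (h2 z w)).symm,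
    fun z w => (mul_assoc_of (h3 z w)).symm⟩

theorem inNucleus_of_mul_eq_one {L : LoopStr Q} {n e : Q} (hn : L.inNucleus n)
    (hne : L.mul n e = L.one) : L.inNucleus e := by
  obtain ⟨n1, n2, n3⟩ := hn
  have l : ∀ w, L.mul n (L.mul e w) = w := fun w => by rw [← n1, hne, L.one_mul]
  have hen : L.mul e n = L.one :=
    L.mul_left_cancel' (x := n) (by rw [l, L.mul_one])
  have r : ∀ w, L.mul (L.mul w e) n = w := fun w => by rw [n3, hen, L.mul_one]
  refine ⟨fun u w => ?_, fun u w => ?_, fun u w => ?_⟩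
  · apply L.mul_left_cancel' (x := n)
    rw [← n1, l, l]
  · nth_rw 1 [← l w]
    rw [← n2, r]
  · apply L.mul_right_cancel' (x := n)
    rw [r, n3, r]

theorem inNucleus_assoc (x y z : Q) : L.inNucleus (L.assoc x y z) := by
  set v := L.mul (L.mul x y) z with hv
  set f := L.c x y z with hf
  have hT : L.T v f = L.c (L.T v x) y z := apply_c₁ (L.T_mem v) _ _ _
  have hn : L.inNucleus (L.T v f) := hT ▸ inNucleus_c _ _ _
  refine inNucleus_of_mul_eq_one hn ?_
  have : L.mul (L.mul v (L.T v f)) (L.assoc x y z) = v := by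
    rw [L.mul_T, ← mul_assoc_c]; exact L.mul_ld _ _
  rw [hn.2.1] at this
  exact L.mul_left_cancel' (this.trans (L.mul_one v).symm)

end

theorem assoc_eq_one {L : LoopStr Q} {x y z : Q}
    (h : L.mul (L.mul x y) z = L.mul x (L.mul y z)) : L.assoc x y z = L.one := by
  apply L.mul_left_cancel' (x := L.mul x (L.mul y z))
  rw [assoc, L.mul_ld, L.mul_one, h]

end LoopStr

/-- In an AIM LC loop, every associator lies in the nucleus. -/
theorem aim_lc_assoc_in_nucleus {Q : Type*} (L : LoopStr Q)
    (hLC : ∀ x y z, L.mul x (L.mul x (L.mul y z)) = L.mul (L.mul x (L.mul x y)) z)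
    (hAIM : L.IsAIM) :
    ∀ x y z u v,
      L.assoc (L.assoc x y z) u v = L.one ∧
      L.assoc u (L.assoc x y z) v = L.one ∧
      L.assoc u v (L.assoc x y z) = L.one := by
  intro x y z u v
  have := LoopStr.AimLC.of_isAIM L hLC hAIM
  obtain ⟨h1, h2, h3⟩ := LoopStr.inNucleus_assoc (L := L) x y z
  exact ⟨LoopStr.assoc_eq_one (h1 u v), LoopStr.assoc_eq_one (h2 u v),
    LoopStr.assoc_eq_one (h3 u v)⟩
end

section
/- Let Q be a loop, let Mlt(Q) be the subgroup of the permutation group of Q generated by all left translations L_x : y ↦ x·y and all right translations R_x : y ↦ y·x, and let Inn(Q) be the subgroup of Mlt(Q) consisting of those permutations φ in Mlt(Q) with φ(1) = 1. Then Inn(Q) is an abelian group if and only if the following identities hold for all u, x, y, z, w in Q: T(T(u,x),y) = T(T(u,y),x), L(L(u,x,y),z,w) = L(L(u,z,w),x,y), R(R(u,x,y),z,w) = R(R(u,z,w),x,y), T(L(u,x,y),z) = L(T(u,z),x,y), T(R(u,x,y),z) = R(T(u,z),x,y), and L(R(u,x,y),z,w) = R(L(u,z,w),x,y). -/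
namespace LoopStr

variable {Q : Type*}

/-- The left translation `L_x : y ↦ x·y` as a permutation of `Q`. -/
def Lperm (L : LoopStr Q) (x : Q) : Equiv.Perm Q :=
  ⟨fun y => L.mul x y, fun y => L.ld x y, L.ld_mul x, L.mul_ld x⟩

/-- The right translation `R_x : y ↦ y·x` as a permutation of `Q`. -/
def Rperm (L : LoopStr Q) (x : Q) : Equiv.Perm Q :=
  ⟨fun y => L.mul y x, fun y => L.rd y x, fun y => L.rd_mul y x, fun y => L.mul_rd y x⟩

/-- The multiplication group `Mlt(Q)`, generated by all translations. -/
def Mlt (L : LoopStr Q) : Subgroup (Equiv.Perm Q) :=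
  Subgroup.closure (Set.range L.Lperm ∪ Set.range L.Rperm)

/-- The inner mapping group `Inn(Q)`: elements of `Mlt(Q)` fixing `1`. -/
def Inn (L : LoopStr Q) : Subgroup (Equiv.Perm Q) :=
  L.Mlt ⊓ MulAction.stabilizer (Equiv.Perm Q) L.one

end LoopStr

namespace LoopStr

variable {Q : Type*}

/-- The inner mapping `u ↦ T(u,x)`. -/
def innT (L : LoopStr Q) (x : Q) : Equiv.Perm Q := (L.Lperm x)⁻¹ * L.Rperm x

/-- The inner mapping `u ↦ L(u,x,y)`. -/
def innL (L : LoopStr Q) (x y : Q) : Equiv.Perm Q :=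
  (L.Lperm (L.mul y x))⁻¹ * (L.Lperm y * L.Lperm x)

/-- The inner mapping `u ↦ R(u,x,y)`. -/
def innR (L : LoopStr Q) (x y : Q) : Equiv.Perm Q :=
  (L.Rperm (L.mul x y))⁻¹ * (L.Rperm y * L.Rperm x)

theorem innT_apply (L : LoopStr Q) (x u : Q) : L.innT x u = L.Tm u x := rfl

theorem innL_apply (L : LoopStr Q) (x y u : Q) : L.innL x y u = L.Lm u x y := rfl

theorem innR_apply (L : LoopStr Q) (x y u : Q) : L.innR x y u = L.Rm u x y := rfl

/-- The standard generators of the inner mapping group. -/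
inductive IsInnGen (L : LoopStr Q) : Equiv.Perm Q → Prop
  | T (x : Q) : IsInnGen L (L.innT x)
  | L (x y : Q) : IsInnGen L (L.innL x y)
  | R (x y : Q) : IsInnGen L (L.innR x y)

theorem Lperm_mem_Mlt (L : LoopStr Q) (x : Q) : L.Lperm x ∈ L.Mlt :=
  Subgroup.subset_closure (Or.inl ⟨x, rfl⟩)

theorem Rperm_mem_Mlt (L : LoopStr Q) (x : Q) : L.Rperm x ∈ L.Mlt :=
  Subgroup.subset_closure (Or.inr ⟨x, rfl⟩)

theorem Tm_one (L : LoopStr Q) (x : Q) : L.Tm L.one x = L.one := by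
  have h := L.ld_mul x L.one
  rw [L.mul_one] at h
  rw [Tm, L.one_mul, h]

theorem Lm_one (L : LoopStr Q) (x y : Q) : L.Lm L.one x y = L.one := by
  have h := L.ld_mul (L.mul y x) L.one
  rw [L.mul_one] at h
  rw [Lm, L.mul_one, h]

theorem Rm_one (L : LoopStr Q) (x y : Q) : L.Rm L.one x y = L.one := by
  have h := L.rd_mul L.one (L.mul x y)
  rw [L.one_mul] at h
  rw [Rm, L.one_mul, h]

theorem IsInnGen.mem_Inn {L : LoopStr Q} {f : Equiv.Perm Q} (hf : L.IsInnGen f) :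
    f ∈ L.Inn := by
  rcases hf with x | ⟨x, y⟩ | ⟨x, y⟩
  · exact ⟨L.Mlt.mul_mem (inv_mem (L.Lperm_mem_Mlt _)) (L.Rperm_mem_Mlt _), L.Tm_one x⟩
  · exact ⟨L.Mlt.mul_mem (inv_mem (L.Lperm_mem_Mlt _))
      (mul_mem (L.Lperm_mem_Mlt _) (L.Lperm_mem_Mlt _)), L.Lm_one x y⟩
  · exact ⟨L.Mlt.mul_mem (inv_mem (L.Rperm_mem_Mlt _))
      (mul_mem (L.Rperm_mem_Mlt _) (L.Rperm_mem_Mlt _)), L.Rm_one x y⟩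

theorem Lperm_mul_Lperm (L : LoopStr Q) (x a : Q) :
    L.Lperm x * L.Lperm a = L.Lperm (L.mul x a) * L.innL a x := by
  simp [innL]

theorem Rperm_mul_Lperm (L : LoopStr Q) (x a : Q) :
    L.Rperm x * L.Lperm a =
      L.Lperm (L.mul a x) * (L.innT (L.mul a x) * L.innR a x * (L.innT a)⁻¹) := by
  simp [innT, innR, mul_assoc]

theorem exists_eq_Lperm_mul (L : LoopStr Q) {g : Equiv.Perm Q} (hg : g ∈ L.Mlt) :
    ∃ a, ∃ k ∈ Subgroup.closure {f | L.IsInnGen f}, g = L.Lperm a * k := by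
  have gen {f : Equiv.Perm Q} (hf : L.IsInnGen f) :
      f ∈ Subgroup.closure {f | L.IsInnGen f} := Subgroup.subset_closure hf
  have hR (a x : Q) : L.innT (L.mul a x) * L.innR a x * (L.innT a)⁻¹ ∈
      Subgroup.closure {f | L.IsInnGen f} :=
    mul_mem (mul_mem (gen (.T _)) (gen (.R _ _))) (inv_mem (gen (.T _)))
  induction hg using Subgroup.closure_induction_left with
  | one =>
    refine ⟨L.one, 1, one_mem _, ?_⟩
    ext y
    exact (L.one_mul y).symm
  | mul_left f hf g _ ih =>
    obtain ⟨a, k, hk, rfl⟩ := ih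
    rcases hf with ⟨x, rfl⟩ | ⟨x, rfl⟩
    · exact ⟨_, _, mul_mem (gen (.L a x)) hk, by
        rw [← mul_assoc, Lperm_mul_Lperm, mul_assoc]⟩
    · exact ⟨_, _, mul_mem (hR a x) hk, by
        rw [← mul_assoc, Rperm_mul_Lperm, mul_assoc]⟩
  | inv_mul_cancel f hf g _ ih =>
    obtain ⟨a, k, hk, rfl⟩ := ih
    rcases hf with ⟨x, rfl⟩ | ⟨x, rfl⟩
    · refine ⟨L.ld x a, _, mul_mem (inv_mem (gen (.L (L.ld x a) x))) hk, ?_⟩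
      have h := L.Lperm_mul_Lperm x (L.ld x a)
      rw [L.mul_ld] at h
      rw [inv_mul_eq_iff_eq_mul, ← mul_assoc, h]
      group
    · refine ⟨L.rd a x, _, mul_mem (inv_mem (hR (L.rd a x) x)) hk, ?_⟩
      have h := L.Rperm_mul_Lperm x (L.rd a x)
      rw [inv_mul_eq_iff_eq_mul, ← mul_assoc, h, mul_assoc, mul_inv_cancel_left, L.mul_rd]

/-- The inner mapping group is generated by the standard inner mappings. -/
theorem closure_isInnGen (L : LoopStr Q) : Subgroup.closure {f | L.IsInnGen f} = L.Inn := by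
  have hle : Subgroup.closure {f | L.IsInnGen f} ≤ L.Inn :=
    (Subgroup.closure_le _).2 fun _ hf => hf.mem_Inn
  refine le_antisymm hle fun g hg => ?_
  obtain ⟨a, k, hk, rfl⟩ := L.exists_eq_Lperm_mul hg.1
  have hk1 : k L.one = L.one := (hle hk).2
  have ha : L.mul a (k L.one) = L.one := hg.2
  rw [hk1, L.mul_one] at ha
  have h1 : L.Lperm a = 1 := by
    ext y
    rw [ha]
    exact L.one_mul y
  rwa [h1, _root_.one_mul]

theorem IsAIM.commute {L : LoopStr Q} (h : L.IsAIM) {f g : Equiv.Perm Q}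
    (hf : L.IsInnGen f) (hg : L.IsInnGen g) : Commute f g := by
  obtain ⟨hTT, hLL, hRR, hTL, hTR, hLR⟩ := h
  ext u
  rcases hf with x | ⟨x, y⟩ | ⟨x, y⟩ <;> rcases hg with z | ⟨z, w⟩ | ⟨z, w⟩ <;>
    simp only [Equiv.Perm.mul_apply, innT_apply, innL_apply, innR_apply]
  · exact hTT u z x
  · exact hTL u z w x
  · exact hTR u z w x
  · exact (hTL u x y z).symm
  · exact hLL u z w x y
  · exact hLR u z w x y
  · exact (hTR u x y z).symm
  · exact (hLR u x y z w).symm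
  · exact hRR u z w x y

theorem IsAIM.commute_of_mem_closure {L : LoopStr Q} (h : L.IsAIM) {f g : Equiv.Perm Q}
    (hf : f ∈ Subgroup.closure {f | L.IsInnGen f})
    (hg : g ∈ Subgroup.closure {f | L.IsInnGen f}) : Commute f g := by
  induction hf, hg using Subgroup.closure_induction₂ with
  | mem f g hf hg => exact h.commute hf hg
  | one_left => exact Commute.one_left _
  | one_right => exact Commute.one_right _
  | mul_left _ _ _ _ _ _ h₁ h₂ => exact h₁.mul_left h₂
  | mul_right _ _ _ _ _ _ h₁ h₂ => exact h₁.mul_right h₂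
  | inv_left _ _ _ _ h => exact h.inv_left
  | inv_right _ _ _ _ h => exact h.inv_right

end LoopStr

/-- `Inn(Q)` is abelian iff the six AIM identities hold. -/
theorem inn_abelian_iff_aim {Q : Type*} (L : LoopStr Q) :
    (∀ f g : L.Inn, f * g = g * f) ↔ L.IsAIM := by
  constructor
  · intro h
    have hc {f g : Equiv.Perm Q} (hf : L.IsInnGen f) (hg : L.IsInnGen g) (u : Q) :
        f (g u) = g (f u) :=
      congrArg (fun k : L.Inn => (k : Equiv.Perm Q) u) (h ⟨f, hf.mem_Inn⟩ ⟨g, hg.mem_Inn⟩)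
    exact ⟨fun u x y => hc (.T y) (.T x) u, fun u x y z w => hc (.L z w) (.L x y) u,
      fun u x y z w => hc (.R z w) (.R x y) u, fun u x y z => hc (.T z) (.L x y) u,
      fun u x y z => hc (.T z) (.R x y) u, fun u x y z w => hc (.L z w) (.R x y) u⟩
  · rintro h ⟨f, hf⟩ ⟨g, hg⟩
    rw [← L.closure_isInnGen] at hf hg
    exact Subtype.ext (h.commute_of_mem_closure hf hg)
end

section
/- Let Q be a loop, let Mlt(Q) be the subgroup of the permutation group of Q generated by all left translations L_x : y ↦ x·y and all right translations R_x : y ↦ y·x, and let Inn(Q) = { φ ∈ Mlt(Q) : φ(1) = 1 } be the inner mapping group. Then Inn(Q) equals the subgroup of the permutation group of Q generated by the set of all mappings R_{x,y} = R_x ∘then R_y ∘then R_{x·y}^{-1}, T_x = R_x ∘then L_x^{-1}, and L_{x,y} = L_x ∘then L_y ∘then L_{y·x}^{-1}, for x, y ranging over Q (composition applied left to right: u ↦ (((u·x)·y) / (x·y)), u ↦ x\(u·x), and u ↦ (y·x)\(y·(x·u)) respectively). -/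
namespace LoopStr

variable {Q : Type*}

/-- `R_{x,y} = R_x R_y R_{x·y}^{-1}` (composition left to right),
i.e. `u ↦ ((u·x)·y)/(x·y)`. -/
def Rgen (L : LoopStr Q) (x y : Q) : Equiv.Perm Q :=
  ((L.Rperm x).trans (L.Rperm y)).trans (L.Rperm (L.mul x y)).symm

/-- `T_x = R_x L_x^{-1}` (composition left to right), i.e. `u ↦ x\(u·x)`. -/
def Tgen (L : LoopStr Q) (x : Q) : Equiv.Perm Q :=
  (L.Rperm x).trans (L.Lperm x).symm

/-- `L_{x,y} = L_x L_y L_{y·x}^{-1}` (composition left to right),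
i.e. `u ↦ (y·x)\(y·(x·u))`. -/
def Lgen (L : LoopStr Q) (x y : Q) : Equiv.Perm Q :=
  ((L.Lperm x).trans (L.Lperm y)).trans (L.Lperm (L.mul y x)).symm

end LoopStr

namespace LoopStr

variable {Q : Type*}

theorem Rgen_eq (L : LoopStr Q) (x y : Q) :
    L.Rgen x y = (L.Rperm (L.mul x y))⁻¹ * (L.Rperm y * L.Rperm x) := rfl

theorem Tgen_eq (L : LoopStr Q) (x : Q) : L.Tgen x = (L.Lperm x)⁻¹ * L.Rperm x := rfl

theorem Lgen_eq (L : LoopStr Q) (x y : Q) :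
    L.Lgen x y = (L.Lperm (L.mul y x))⁻¹ * (L.Lperm y * L.Lperm x) := rfl

theorem Rperm_one (L : LoopStr Q) : L.Rperm L.one = 1 :=
  Equiv.ext L.mul_one

theorem Rgen_mem_Inn (L : LoopStr Q) (x y : Q) : L.Rgen x y ∈ L.Inn := by
  refine ⟨?_, ?_⟩
  · rw [Rgen_eq]
    exact L.Mlt.mul_mem (L.Mlt.inv_mem (L.Rperm_mem_Mlt _))
      (L.Mlt.mul_mem (L.Rperm_mem_Mlt _) (L.Rperm_mem_Mlt _))
  · change L.rd (L.mul (L.mul L.one x) y) (L.mul x y) = L.one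
    rw [L.one_mul]
    simpa only [L.one_mul] using L.rd_mul L.one (L.mul x y)

theorem Tgen_mem_Inn (L : LoopStr Q) (x : Q) : L.Tgen x ∈ L.Inn := by
  refine ⟨?_, ?_⟩
  · rw [Tgen_eq]
    exact L.Mlt.mul_mem (L.Mlt.inv_mem (L.Lperm_mem_Mlt _)) (L.Rperm_mem_Mlt _)
  · change L.ld x (L.mul L.one x) = L.one
    simpa only [L.one_mul, L.mul_one] using L.ld_mul x L.one

theorem Lgen_mem_Inn (L : LoopStr Q) (x y : Q) : L.Lgen x y ∈ L.Inn := by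
  refine ⟨?_, ?_⟩
  · rw [Lgen_eq]
    exact L.Mlt.mul_mem (L.Mlt.inv_mem (L.Lperm_mem_Mlt _))
      (L.Mlt.mul_mem (L.Lperm_mem_Mlt _) (L.Lperm_mem_Mlt _))
  · change L.ld (L.mul y x) (L.mul y (L.mul x L.one)) = L.one
    rw [L.mul_one]
    simpa only [L.mul_one] using L.ld_mul (L.mul y x) L.one

/-- The Schreier elements of `Mlt(Q)` with respect to the transversal of right translations lie in
every subgroup containing the maps `R_{x,y}`, `T_x` and `L_{x,y}`. -/
theorem Rperm_inv_mul_mul_Rperm_mem (L : LoopStr Q) {H : Subgroup (Equiv.Perm Q)}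
    (hR : ∀ x y, L.Rgen x y ∈ H) (hT : ∀ x, L.Tgen x ∈ H) (hL : ∀ x y, L.Lgen x y ∈ H)
    {g : Equiv.Perm Q} (hg : g ∈ L.Mlt) (x : Q) :
    (L.Rperm (g x))⁻¹ * g * L.Rperm x ∈ H := by
  induction hg using Subgroup.closure_induction generalizing x with
  | mem g hg =>
    rcases hg with ⟨y, rfl⟩ | ⟨y, rfl⟩
    · have h := mul_mem (mul_mem (inv_mem (hT (L.mul y x))) (hL x y)) (hT x)
      rw [Tgen_eq, Tgen_eq, Lgen_eq] at h
      change (L.Rperm (L.mul y x))⁻¹ * L.Lperm y * L.Rperm x ∈ H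
      convert h using 1
      group
    · have h := hR x y
      rwa [Rgen_eq, ← mul_assoc] at h
  | one => simp
  | mul g k _ _ ihg ihk =>
    convert mul_mem (ihg (k x)) (ihk x) using 1
    rw [Equiv.Perm.mul_apply]
    group
  | inv g _ ih =>
    have h := inv_mem (ih (g⁻¹ x))
    rw [show g (g⁻¹ x) = x from g.apply_symm_apply x] at h
    convert h using 1
    group

end LoopStr

/-- Bruck's theorem: `Inn(Q)` is generated by the maps `R_{x,y}`, `T_x`, `L_{x,y}`. -/
theorem inn_eq_closure_generators {Q : Type*} (L : LoopStr Q) :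
    L.Inn = Subgroup.closure
      {f : Equiv.Perm Q |
        (∃ x y, f = L.Rgen x y) ∨ (∃ x, f = L.Tgen x) ∨ (∃ x y, f = L.Lgen x y)} := by
  refine le_antisymm ?_ ?_
  · rintro g ⟨hg, hfix⟩
    have h := L.Rperm_inv_mul_mul_Rperm_mem
      (H := Subgroup.closure {f | (∃ x y, f = L.Rgen x y) ∨ (∃ x, f = L.Tgen x) ∨
        (∃ x y, f = L.Lgen x y)})
      (fun x y => Subgroup.subset_closure (Or.inl ⟨x, y, rfl⟩))
      (fun x => Subgroup.subset_closure (Or.inr (Or.inl ⟨x, rfl⟩)))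
      (fun x y => Subgroup.subset_closure (Or.inr (Or.inr ⟨x, y, rfl⟩))) hg L.one
    rw [show g L.one = L.one from hfix, L.Rperm_one] at h
    simpa only [inv_one, one_mul, mul_one] using h
  · rw [Subgroup.closure_le]
    rintro f (⟨x, y, rfl⟩ | ⟨x, rfl⟩ | ⟨x, y, rfl⟩)
    exacts [L.Rgen_mem_Inn x y, L.Tgen_mem_Inn x, L.Lgen_mem_Inn x y]
end

section
/- Let Q be a loop in which every associator and every commutator is central, i.e., for all x, y, z in Q the elements [x,y,z] and [x,y] commute with every element of Q and associate with every pair of elements of Q (so [x,y,z] ∈ Z(Q) and [x,y] ∈ Z(Q)). Then Q is an AIM loop; that is, the six identities T(T(u,x),y) = T(T(u,y),x), L(L(u,x,y),z,w) = L(L(u,z,w),x,y), R(R(u,x,y),z,w) = R(R(u,z,w),x,y), T(L(u,x,y),z) = L(T(u,z),x,y), T(R(u,x,y),z) = R(T(u,z),x,y), and L(R(u,x,y),z,w) = R(L(u,z,w),x,y) hold for all u,x,y,z,w in Q. -/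
namespace LoopStr

variable {Q : Type*} {L : LoopStr Q}

theorem mul_left_injective (L : LoopStr Q) {a x y : Q} (h : L.mul a x = L.mul a y) : x = y := by
  rw [← L.ld_mul a x, h, L.ld_mul]

theorem mul_right_injective (L : LoopStr Q) {a x y : Q} (h : L.mul x a = L.mul y a) : x = y := by
  rw [← L.rd_mul x a, h, L.rd_mul]

theorem inCenter.mul_right_comm {b : Q} (hb : L.inCenter b) (x a : Q) :
    L.mul (L.mul x a) b = L.mul (L.mul x b) a := by
  rw [hb.2.2.2, ← hb.1, hb.2.2.1]

/-- `f` commutes with multiplication by central elements and fixes every element modulo the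
center. -/
def IsCentralShift (L : LoopStr Q) (f : Q → Q) : Prop :=
  (∀ u a, L.inCenter a → f (L.mul u a) = L.mul (f u) a) ∧
  ∀ u, ∃ a b, L.inCenter a ∧ L.inCenter b ∧ L.mul (f u) a = L.mul u b

theorem IsCentralShift.commute {f g : Q → Q} (hf : L.IsCentralShift f) (hg : L.IsCentralShift g)
    (u : Q) : f (g u) = g (f u) := by
  obtain ⟨a, b, ha, hb, hab⟩ := hf.2 u
  obtain ⟨c, d, hc, hd, hcd⟩ := hg.2 u
  have hfg : L.mul (L.mul (f (g u)) c) a = L.mul (L.mul u b) d := by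
    rw [← hf.1 _ c hc, hcd, hf.1 _ d hd, ha.mul_right_comm, hab]
  have hgf : L.mul (L.mul (g (f u)) a) c = L.mul (L.mul u d) b := by
    rw [← hg.1 _ a ha, hab, hg.1 _ b hb, hc.mul_right_comm, hcd]
  rw [hc.mul_right_comm, hb.mul_right_comm, ← hfg] at hgf
  exact (L.mul_right_injective (L.mul_right_injective hgf)).symm

theorem inCenter_one (L : LoopStr Q) : L.inCenter L.one := by
  simp [inCenter, inNucleus, L.one_mul, L.mul_one]

theorem mul_comm_eq (L : LoopStr Q) (x y : Q) :
    L.mul (L.mul y x) (L.comm x y) = L.mul x y := L.mul_ld _ _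

theorem mul_assoc_eq (L : LoopStr Q) (x y z : Q) :
    L.mul (L.mul x (L.mul y z)) (L.assoc x y z) = L.mul (L.mul x y) z := L.mul_ld _ _

theorem isCentralShift_Tm (hC : ∀ x y, L.inCenter (L.comm x y)) (x : Q) :
    L.IsCentralShift (fun u => L.Tm u x) := by
  refine ⟨fun u a ha => ?_, fun u => ⟨L.one, L.comm u x, L.inCenter_one, hC u x, ?_⟩⟩
  · apply L.mul_left_injective (a := x)
    simp only [Tm]
    rw [L.mul_ld, ← ha.2.2.2, L.mul_ld, ha.mul_right_comm]
  · apply L.mul_left_injective (a := x)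
    simp only [Tm]
    rw [L.mul_one, L.mul_ld, ← (hC u x).2.2.2, L.mul_comm_eq]

theorem isCentralShift_Lm (hA : ∀ x y z, L.inCenter (L.assoc x y z)) (x y : Q) :
    L.IsCentralShift (fun u => L.Lm u x y) := by
  refine ⟨fun u a ha => ?_, fun u => ⟨L.assoc y x u, L.one, hA y x u, L.inCenter_one, ?_⟩⟩
  · apply L.mul_left_injective (a := L.mul y x)
    simp only [Lm]
    rw [L.mul_ld, ← ha.2.2.2 (L.mul y x), L.mul_ld, ← ha.2.2.2, ← ha.2.2.2]
  · apply L.mul_left_injective (a := L.mul y x)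
    simp only [Lm]
    rw [L.mul_one, ← (hA y x u).2.2.2, L.mul_ld, L.mul_assoc_eq]

theorem isCentralShift_Rm (hA : ∀ x y z, L.inCenter (L.assoc x y z)) (x y : Q) :
    L.IsCentralShift (fun u => L.Rm u x y) := by
  refine ⟨fun u a ha => ?_, fun u => ⟨L.one, L.assoc u x y, L.inCenter_one, hA u x y, ?_⟩⟩
  · apply L.mul_right_injective (a := L.mul x y)
    simp only [Rm]
    rw [L.mul_rd, ← ha.mul_right_comm _ (L.mul x y), L.mul_rd, ha.mul_right_comm _ y,
      ha.mul_right_comm u x]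
  · apply L.mul_right_injective (a := L.mul x y)
    simp only [Rm]
    rw [L.mul_one, L.mul_rd, ← (hA u x y).mul_right_comm, L.mul_assoc_eq]

end LoopStr

/-- If every associator and commutator of a loop is central, the loop is AIM. -/
theorem central_assoc_comm_implies_aim {Q : Type*} (L : LoopStr Q)
    (hA : ∀ x y z, L.inCenter (L.assoc x y z))
    (hC : ∀ x y, L.inCenter (L.comm x y)) :
    L.IsAIM := by
  have hT := LoopStr.isCentralShift_Tm hC
  have hL := LoopStr.isCentralShift_Lm hA
  have hR := LoopStr.isCentralShift_Rm hA
  exact ⟨fun u x y => (hT y).commute (hT x) u,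
    fun u x y z w => (hL z w).commute (hL x y) u,
    fun u x y z w => (hR z w).commute (hR x y) u,
    fun u x y z => (hT z).commute (hL x y) u,
    fun u x y z => (hT z).commute (hR x y) u,
    fun u x y z w => (hL z w).commute (hR x y) u⟩
end

section
/- Let Q be a loop. Then the following four identities are pairwise equivalent (each, holding for all x, y, z in Q, implies the others): (1) x·(x·(y·z)) = (x·(x·y))·z; (2) x·(x·(y·z)) = ((x·x)·y)·z; (3) (x·x)·(y·z) = (x·(x·y))·z; (4) x·(y·(y·z)) = (x·(y·y))·z. A loop satisfying any (hence all) of them is called an LC loop. -/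
namespace LoopStr

variable {Q : Type*} (L : LoopStr Q)

lemma mul_left_cancel {a b c : Q} (h : L.mul a b = L.mul a c) : b = c := by
  rw [← L.ld_mul a b, h, L.ld_mul]

/-- A left translation with a right inverse among the left translations has it as a
two-sided inverse. -/
lemma leftInverse_of_rightInverse {x y : Q} (h : ∀ z, L.mul x (L.mul y z) = z) (z : Q) :
    L.mul y (L.mul x z) = z :=
  L.mul_left_cancel (h (L.mul x z))

/-- The left inverse property: the inverse of every left translation is a left translation. -/
def HasLeftInverses : Prop :=
  ∀ x, ∃ x', (∀ z, L.mul x (L.mul x' z) = z) ∧ ∀ z, L.mul x' (L.mul x z) = z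

variable {L}

lemma hasLeftInverses_of_left
    (h : ∀ x y z, L.mul x (L.mul x (L.mul y z)) = L.mul (L.mul x (L.mul x y)) z) :
    L.HasLeftInverses := by
  intro x
  have hr : ∀ z, L.mul x (L.mul (L.ld x L.one) z) = z := fun z => by
    apply L.mul_left_cancel (a := x)
    rw [h, L.mul_ld, L.mul_one]
  exact ⟨_, hr, L.leftInverse_of_rightInverse hr⟩

lemma hasLeftInverses_of_middle
    (h : ∀ x y z, L.mul x (L.mul y (L.mul y z)) = L.mul (L.mul x (L.mul y y)) z) :
    L.HasLeftInverses := by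
  intro y
  have hl : ∀ z, L.mul (L.rd y (L.mul y y)) (L.mul y z) = z := fun z => by
    rw [← L.mul_ld y z, h, L.mul_rd]
  exact ⟨_, L.leftInverse_of_rightInverse hl, hl⟩

/-- With left inverses, the identities `L_x² L_y = L_{x(xy)}` and `L_y L_x² = L_{y(xx)}` are
exchanged by inverting both sides. -/
lemma HasLeftInverses.left_iff_middle (hL : L.HasLeftInverses) :
    (∀ x y z, L.mul x (L.mul x (L.mul y z)) = L.mul (L.mul x (L.mul x y)) z) ↔
      ∀ x y z, L.mul x (L.mul y (L.mul y z)) = L.mul (L.mul x (L.mul y y)) z := by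
  constructor
  · intro h x y
    obtain ⟨x', hx, -⟩ := hL x
    obtain ⟨y', hy, -⟩ := hL y
    obtain ⟨w, -, hw⟩ := hL (L.mul y' (L.mul y' x'))
    have key : ∀ z, L.mul x (L.mul y (L.mul y z)) = L.mul w z := fun z => by
      have := hw (L.mul x (L.mul y (L.mul y z)))
      rw [← h, L.leftInverse_of_rightInverse hx, L.leftInverse_of_rightInverse hy,
        L.leftInverse_of_rightInverse hy] at this
      exact this.symm
    have hone := key L.one
    rw [L.mul_one, L.mul_one] at hone
    intro z
    rw [hone, key]
  · intro h x y
    obtain ⟨x', hx, -⟩ := hL x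
    obtain ⟨y', hy, -⟩ := hL y
    obtain ⟨w, -, hw⟩ := hL (L.mul y' (L.mul x' x'))
    have key : ∀ z, L.mul x (L.mul x (L.mul y z)) = L.mul w z := fun z => by
      have := hw (L.mul x (L.mul x (L.mul y z)))
      rw [← h, L.leftInverse_of_rightInverse hx, L.leftInverse_of_rightInverse hx,
        L.leftInverse_of_rightInverse hy] at this
      exact this.symm
    have hone := key L.one
    rw [L.mul_one, L.mul_one] at hone
    intro z
    rw [hone, key]

end LoopStr

/-- The four defining identities of LC loops are pairwise equivalent in any loop. -/
theorem lc_identities_tfae {Q : Type*} (L : LoopStr Q) :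
    [(∀ x y z, L.mul x (L.mul x (L.mul y z)) = L.mul (L.mul x (L.mul x y)) z),
     (∀ x y z, L.mul x (L.mul x (L.mul y z)) = L.mul (L.mul (L.mul x x) y) z),
     (∀ x y z, L.mul (L.mul x x) (L.mul y z) = L.mul (L.mul x (L.mul x y)) z),
     (∀ x y z, L.mul x (L.mul y (L.mul y z)) = L.mul (L.mul x (L.mul y y)) z)].TFAE := by
  tfae_have 1 → 2 := by
    intro h x y z
    have hx := h x L.one y
    rw [L.one_mul, L.mul_one] at hx
    rw [h, hx]
  tfae_have 2 → 3 := by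
    intro h x y z
    have hx := h x y L.one
    have hyz := h x (L.mul y z) L.one
    simp only [L.mul_one] at hx hyz
    rw [hx, ← hyz, h]
  tfae_have 3 → 1 := by
    intro h x y z
    have hyz := h x (L.mul y z) L.one
    simp only [L.mul_one] at hyz
    rw [← hyz, h]
  tfae_have 1 → 4 := fun h => (LoopStr.hasLeftInverses_of_left h).left_iff_middle.mp h
  tfae_have 4 → 1 := fun h => (LoopStr.hasLeftInverses_of_middle h).left_iff_middle.mpr h
  tfae_finish
end

section
/- Let Q be an LC loop (a loop satisfying x·(x·(y·z)) = (x·(x·y))·z for all x,y,z). Then the left nucleus and the middle nucleus of Q coincide: an element a satisfies (a·x)·y = a·(x·y) for all x,y if and only if it satisfies (x·a)·y = x·(a·y) for all x,y. -/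
namespace LoopStr

/-- The left inverse property of LC loops: `(x \ 1)·(x·z) = z` and
`x·((x \ 1)·z) = z`. -/
theorem left_inverse_property {Q : Type*} (L : LoopStr Q)
    (hLC : ∀ x y z, L.mul x (L.mul x (L.mul y z)) = L.mul (L.mul x (L.mul x y)) z) (x z : Q) :
    L.mul x (L.mul (L.ld x L.one) z) = z ∧ L.mul (L.ld x L.one) (L.mul x z) = z := by
  have cancel : ∀ {u v : Q}, L.mul x u = L.mul x v → u = v := fun {u v} h => by
    rw [← L.ld_mul x u, h, L.ld_mul]
  have right : ∀ z, L.mul x (L.mul (L.ld x L.one) z) = z := fun z => cancel <| by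
    rw [hLC, L.mul_ld, L.mul_one]
  exact ⟨right z, cancel (right _)⟩

/-- If left multiplication by `w` is a left inverse of `f` in a loop with the left inverse property,
then `f` is left multiplication by `f 1`. -/
theorem mul_map_one_of_leftInverse {Q : Type*} (L : LoopStr Q)
    (hinv : ∀ x z, L.mul (L.ld x L.one) (L.mul x z) = z) {f : Q → Q} {w : Q}
    (hw : ∀ y, L.mul w (f y) = y) (y : Q) : L.mul (f L.one) y = f y := by
  have h : f L.one = L.ld w L.one := by
    rw [← L.ld_mul w (f L.one), hw]
  calc L.mul (f L.one) y = L.mul (L.ld w L.one) (L.mul w (f y)) := by rw [h, hw]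
    _ = f y := hinv w (f y)

end LoopStr

/-- In an LC loop, the left nucleus and middle nucleus coincide. -/
theorem lc_left_nucleus_eq_middle_nucleus {Q : Type*} (L : LoopStr Q)
    (hLC : ∀ x y z, L.mul x (L.mul x (L.mul y z)) = L.mul (L.mul x (L.mul x y)) z) :
    ∀ a, (∀ x y, L.mul (L.mul a x) y = L.mul a (L.mul x y)) ↔
         (∀ x y, L.mul (L.mul x a) y = L.mul x (L.mul a y)) := by
  have hr := fun x z => (L.left_inverse_property hLC x z).1
  have hl := fun x z => (L.left_inverse_property hLC x z).2
  intro a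
  constructor
  · intro ha x y
    have ha' : ∀ x y, L.mul (L.mul (L.ld a L.one) x) y = L.mul (L.ld a L.one) (L.mul x y) := by
      intro x y
      rw [← hl a (L.mul (L.mul (L.ld a L.one) x) y), ← ha, hr]
    have key := L.mul_map_one_of_leftInverse hl (f := fun y => L.mul x (L.mul a y))
      (w := L.mul (L.ld a L.one) (L.ld x L.one)) (fun y => by rw [ha', hl, hl]) y
    simpa only [L.mul_one] using key
  · intro ha x y
    have ha' : ∀ x y, L.mul (L.mul x (L.ld a L.one)) y = L.mul x (L.mul (L.ld a L.one) y) := by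
      intro x y
      rw [← L.mul_rd x a, ha, ha, hr, L.mul_ld, L.mul_one]
    have key := L.mul_map_one_of_leftInverse hl (f := fun y => L.mul a (L.mul x y))
      (w := L.mul (L.ld x L.one) (L.ld a L.one)) (fun y => by rw [ha', hl, hl]) y
    simpa only [L.mul_one] using key
end
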